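/- Let q : [1, ∞) → ℂ be a function with q(x) = o(1) as x → +∞ (and locally integrable). Then there exists a completely multiplicative function χ : ℕ → ℂ with |χ(n)| = 1 for all n ≥ 1 such that the function s ↦ ∫₁^∞ q(x) x^{-s} dx + Σ_p χ(p) p^{-s} log p (the sum over all primes p), initially defined and analytic in the half-plane Re s > 1, extends analytically to the half-plane Re s > 21/40. -/

import Mathlib

open Complex Filter Topology Set MeasureTheory


/-- Terms of the series for `(s-1) ζ(s) - 1`. -/
noncomputable def zterm (n : ℕ) (s : ℂ) : ℂ :=
  (s - 1) * ((n + 1 : ℝ) : ℂ) ^ (-s) - ((n + 1 : ℝ) : ℂ) ^ (1 - s) + ((n + 2 : ℝ) : ℂ) ^ (1 - s)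

lemma zterm_eq_integral (n : ℕ) {s : ℂ} (hs : s ≠ 1) :
    zterm n s = (s - 1) * ∫ u in (n + 1 : ℝ)..(n + 2 : ℝ),
      (((n + 1 : ℝ) : ℂ) ^ (-s) - (u : ℂ) ^ (-s)) := by
  have h0 : (0 : ℝ) ∉ Set.uIcc (n + 1 : ℝ) (n + 2 : ℝ) := by
    rw [Set.uIcc_of_le (by linarith)]
    intro h
    have := h.1
    have : (0 : ℝ) ≤ n := n.cast_nonneg
    linarith
  have hne : -s ≠ -1 := by
    intro h; apply hs; linear_combination -h
  rw [intervalIntegral.integral_sub]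
  · rw [intervalIntegral.integral_const, integral_cpow (Or.inr ⟨hne, h0⟩)]
    have h1 : s - 1 ≠ 0 := sub_ne_zero.mpr hs
    have h2 : -s + 1 ≠ 0 := by
      intro h; apply h1; linear_combination -h
    rw [show -s + 1 = 1 - s by ring] at *
    unfold zterm
    rw [mul_sub, show (1 - s) = -(s - 1) by ring]
    rw [show ((n : ℝ) + 2 - (n + 1)) = 1 by ring, one_smul]
    field_simp
    ring
  · exact intervalIntegrable_const
  · exact intervalIntegral.intervalIntegrable_cpow (Or.inr h0)

lemma cpow_sub_bound {m u : ℝ} (hm : 0 < m) (hmu : m ≤ u) (hu1 : u ≤ m + 1) {s : ℂ}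
    (hs : 0 < s.re) :
    ‖(m : ℂ) ^ (-s) - (u : ℂ) ^ (-s)‖ ≤ ‖s‖ * m ^ (-s.re - 1) := by
  have := Convex.norm_image_sub_le_of_norm_hasDerivWithin_le (f := fun x : ℝ => (x : ℂ) ^ (-s))
    (f' := fun x : ℝ => (-s) * (x : ℂ) ^ (-s - 1)) (s := Set.Icc m u) (C := ‖s‖ * m ^ (-s.re - 1))
    (x := u) (y := m) ?_ ?_ (convex_Icc m u) ⟨hmu, le_rfl⟩ ⟨le_rfl, hmu⟩
  · refine this.trans ?_
    have h1 : ‖m - u‖ ≤ 1 := by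
      rw [Real.norm_eq_abs, abs_le]; constructor <;> linarith
    have h2 : 0 ≤ ‖s‖ * m ^ (-s.re - 1) := by positivity
    nlinarith
  · intro x hx
    have hx0 : 0 < x := hm.trans_le hx.1
    have h := hasDerivAt_ofReal_cpow_const (x := x) hx0.ne' (r := -s) (by
      intro h
      have : s = 0 := by linear_combination -h
      rw [this] at hs; simp at hs)
    exact h.hasDerivWithinAt
  · intro x hx
    have hx0 : 0 < x := hm.trans_le hx.1
    rw [norm_mul, norm_neg, Complex.norm_cpow_eq_rpow_re_of_pos hx0]
    gcongr
    simp only [sub_re, neg_re, one_re]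
    exact Real.rpow_le_rpow_of_nonpos hm hx.1 (by linarith)

lemma zterm_bound1 (n : ℕ) {s : ℂ} (hs : 0 < s.re) :
    ‖zterm n s‖ ≤ ‖s - 1‖ * (‖s‖ * (n + 1 : ℝ) ^ (-s.re - 1)) := by
  by_cases h1 : s = 1
  · subst h1; simp [zterm]
  rw [zterm_eq_integral n h1, norm_mul]
  gcongr
  have hn : (0 : ℝ) ≤ n := n.cast_nonneg
  refine (intervalIntegral.norm_integral_le_of_norm_le_const
    (C := ‖s‖ * (n + 1 : ℝ) ^ (-s.re - 1)) ?_).trans ?_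
  · intro x hx
    rw [Set.uIoc_of_le (by linarith)] at hx
    exact cpow_sub_bound (by linarith) hx.1.le (by linarith [hx.2]) hs
  · rw [show ((n : ℝ) + 2 - (n + 1)) = 1 by ring]; simp

lemma zterm_bound2 (n : ℕ) {s : ℂ} (hs : 0 < s.re) :
    ‖zterm n s‖ ≤ ‖s - 1‖ * (2 * (n + 1 : ℝ) ^ (-s.re)) := by
  by_cases h1 : s = 1
  · subst h1; simp [zterm]
  rw [zterm_eq_integral n h1, norm_mul]
  gcongr
  have hn : (0 : ℝ) ≤ n := n.cast_nonneg
  refine (intervalIntegral.norm_integral_le_of_norm_le_const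
    (C := 2 * (n + 1 : ℝ) ^ (-s.re)) ?_).trans ?_
  · intro x hx
    rw [Set.uIoc_of_le (by linarith)] at hx
    refine (norm_sub_le _ _).trans ?_
    rw [Complex.norm_cpow_eq_rpow_re_of_pos (by linarith), Complex.norm_cpow_eq_rpow_re_of_pos (by linarith [hx.1])]
    have := Real.rpow_le_rpow_of_nonpos (z := (-s).re) (by linarith : (0 : ℝ) < n + 1) hx.1.le (by simpa using hs.le)
    simp only [neg_re] at *
    linarith
  · rw [show ((n : ℝ) + 2 - (n + 1)) = 1 by ring]; simp

lemma zterm_bound (n : ℕ) {s : ℂ} (hs : 0 < s.re) {θ : ℝ} (h0 : 0 ≤ θ) (h1 : θ ≤ 1) :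
    ‖zterm n s‖ ≤ ‖s - 1‖ * (2 * ‖s‖ ^ θ * (n + 1 : ℝ) ^ (-s.re - θ)) := by
  set z := ‖zterm n s‖
  have hz : 0 ≤ z := norm_nonneg _
  have hn : (0 : ℝ) < (n : ℝ) + 1 := by positivity
  have e : z = z ^ (1 - θ) * z ^ θ := by
    rcases hz.eq_or_lt with h | h
    · rw [← h]
      by_cases hθ : θ = 0
      · simp [hθ]
      · rw [Real.zero_rpow hθ]; simp
    · rw [← Real.rpow_add h]; simp
  rw [e]
  calc z ^ (1 - θ) * z ^ θ ≤ (‖s - 1‖ * (2 * (n + 1 : ℝ) ^ (-s.re))) ^ (1 - θ) *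
      (‖s - 1‖ * (‖s‖ * (n + 1 : ℝ) ^ (-s.re - 1))) ^ θ := by
        gcongr
        · exact zterm_bound2 n hs
        · exact zterm_bound1 n hs
    _ = (‖s - 1‖ ^ (1 - θ) * ‖s - 1‖ ^ θ) * (2 ^ (1 - θ) * ‖s‖ ^ θ *
        (((n + 1 : ℝ) ^ (-s.re)) ^ (1 - θ) * ((n + 1 : ℝ) ^ (-s.re - 1)) ^ θ)) := by
        rw [Real.mul_rpow (by positivity) (by positivity), Real.mul_rpow (by positivity) (by positivity),
          Real.mul_rpow (by positivity) (by positivity), Real.mul_rpow (by positivity) (by positivity)]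
        ring
    _ ≤ _ := by
        rw [← Real.rpow_mul hn.le, ← Real.rpow_mul hn.le, ← Real.rpow_add hn]
        rw [show -s.re * (1 - θ) + (-s.re - 1) * θ = -s.re - θ by ring]
        have e2 : ‖s - 1‖ ^ (1 - θ) * ‖s - 1‖ ^ θ = ‖s - 1‖ := by
          rw [← Real.rpow_add_of_nonneg (norm_nonneg _) (by linarith) h0]; simp
        rw [e2]
        gcongr
        calc (2 : ℝ) ^ (1 - θ) ≤ 2 ^ (1 : ℝ) := Real.rpow_le_rpow_of_exponent_le (by norm_num) (by linarith)
          _ = 2 := by norm_num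

lemma summable_succ_rpow {a : ℝ} (ha : a < -1) : Summable (fun n : ℕ => (n + 1 : ℝ) ^ a) := by
  have := (summable_nat_add_iff 1).mpr (Real.summable_nat_rpow.mpr ha)
  simpa using this

lemma zterm_hasSum {s : ℂ} (hs : 1 < s.re) : HasSum (fun n => zterm n s) (riemannZeta₁ s - 1) := by
  have hsum : Summable (fun n => zterm n s) := by
    apply Summable.of_norm_bounded (g := fun n : ℕ => ‖s - 1‖ * (‖s‖ * (n + 1 : ℝ) ^ (-s.re - 1)))
    · exact ((summable_succ_rpow (by linarith)).mul_left _).mul_left _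
    · exact fun n => zterm_bound1 n (by linarith)
  have hpart : ∀ N : ℕ, ∑ n ∈ Finset.range N, zterm n s =
      (s - 1) * (∑ n ∈ Finset.range N, 1 / ((n : ℂ) + 1) ^ s) - 1 + ((N + 1 : ℝ) : ℂ) ^ (1 - s) := by
    intro N
    induction N with
    | zero => simp
    | succ N ih =>
      rw [Finset.sum_range_succ, ih, Finset.sum_range_succ, zterm, Complex.cpow_neg]
      push_cast
      rw [show (N : ℂ) + 1 + 1 = N + 2 by ring]
      ring
  have hz : Tendsto (fun N : ℕ => ((N + 1 : ℝ) : ℂ) ^ (1 - s)) atTop (𝓝 0) := by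
    rw [tendsto_zero_iff_norm_tendsto_zero]
    have : ∀ N : ℕ, ‖((N + 1 : ℝ) : ℂ) ^ (1 - s)‖ = (N + 1 : ℝ) ^ (-(s.re - 1)) := by
      intro N
      rw [Complex.norm_cpow_eq_rpow_re_of_pos (by positivity)]
      simp
    simp_rw [this]
    exact (tendsto_rpow_neg_atTop (by linarith)).comp
      (tendsto_atTop_add_const_right _ _ tendsto_natCast_atTop_atTop)
  have hzeta : Tendsto (fun N : ℕ => ∑ n ∈ Finset.range N, 1 / ((n : ℂ) + 1) ^ s) atTop
      (𝓝 (riemannZeta s)) := by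
    rw [zeta_eq_tsum_one_div_nat_add_one_cpow hs]
    have := (summable_nat_add_iff 1).mpr (Complex.summable_one_div_nat_cpow.mpr hs)
    push_cast at this
    exact this.hasSum.tendsto_sum_nat
  have h1 : s ≠ 1 := by intro h; rw [h] at hs; simp at hs
  have hlim := ((hzeta.const_mul (s - 1)).sub_const 1).add hz
  have : Tendsto (fun N => ∑ n ∈ Finset.range N, zterm n s) atTop (𝓝 (riemannZeta₁ s - 1)) := by
    simp_rw [hpart]
    convert hlim using 2
    rw [riemannZeta_eq_inv_sub_mul h1]
    have : s - 1 ≠ 0 := sub_ne_zero.mpr h1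
    field_simp
    ring
  rw [← tendsto_nhds_unique hsum.hasSum.tendsto_sum_nat this]
  exact hsum.hasSum

lemma differentiable_zterm (n : ℕ) : Differentiable ℂ (zterm n) := by
  unfold zterm
  have h1 : ((n + 1 : ℝ) : ℂ) ≠ 0 := by
    norm_cast
  have h2 : ((n + 2 : ℝ) : ℂ) ≠ 0 := by
    norm_cast
  intro s
  refine ((DifferentiableAt.mul (by fun_prop) ?_).sub ?_).add ?_
  · exact DifferentiableAt.const_cpow (by fun_prop) (Or.inl h1)
  · exact DifferentiableAt.const_cpow (by fun_prop) (Or.inl h1)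
  · exact DifferentiableAt.const_cpow (by fun_prop) (Or.inl h2)

lemma zterm_summable {s : ℂ} (hs : 0 < s.re) : Summable (fun n => zterm n s) := by
  apply Summable.of_norm_bounded (g := fun n : ℕ => ‖s - 1‖ * (‖s‖ * (n + 1 : ℝ) ^ (-s.re - 1)))
  · exact ((summable_succ_rpow (by linarith)).mul_left _).mul_left _
  · exact fun n => zterm_bound1 n (by linarith)

lemma zeta1_eq_tsum {s : ℂ} (hs : 0 < s.re) : riemannZeta₁ s - 1 = ∑' n, zterm n s := by
  have hopen : IsOpen {s : ℂ | 0 < s.re} := isOpen_lt continuous_const Complex.continuous_re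
  have hconv : Convex ℝ {s : ℂ | 0 < s.re} := convex_halfSpace_re_gt 0
  have hd : DifferentiableOn ℂ (fun s => ∑' n, zterm n s) {s : ℂ | 0 < s.re} := by
    intro s hs
    simp only [Set.mem_ofPred_eq] at hs
    set U : Set ℂ := {w | s.re / 2 < w.re} ∩ Metric.ball 0 (‖s‖ + 1)
    have hU : IsOpen U := (isOpen_lt continuous_const Complex.continuous_re).inter Metric.isOpen_ball
    have hsU : s ∈ U := ⟨by simp; linarith, by simp⟩
    have := differentiableOn_tsum_of_summable_norm (F := fun n => zterm n) (U := U)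
      (u := fun n : ℕ => (‖s‖ + 2) * ((‖s‖ + 1) * (n + 1 : ℝ) ^ (-(s.re / 2) - 1)))
      (((summable_succ_rpow (by linarith)).mul_left _).mul_left _)
      (fun n => (differentiable_zterm n).differentiableOn) hU ?_
    · exact (this.differentiableAt (hU.mem_nhds hsU)).differentiableWithinAt
    · intro n w hw
      have hw1 : s.re / 2 < w.re := hw.1
      have hw2 : ‖w‖ < ‖s‖ + 1 := by simpa using hw.2
      refine (zterm_bound1 n (by linarith)).trans ?_
      have : ‖w - 1‖ ≤ ‖s‖ + 2 := by
        refine (norm_sub_le _ _).trans ?_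
        simp only [norm_one]; linarith
      gcongr
      · linarith [(n.cast_nonneg : (0 : ℝ) ≤ n)]
  have h := AnalyticOnNhd.eqOn_of_preconnected_of_eventuallyEq
    (f := fun s => riemannZeta₁ s - 1) (g := fun s => ∑' n, zterm n s)
    (U := {s : ℂ | 0 < s.re})
    ((differentiable_riemannZeta₁.sub_const 1).differentiableOn.analyticOnNhd hopen)
    (hd.analyticOnNhd hopen) hconv.isPreconnected (z₀ := 2) (by simp) ?_
  · exact h hs
  · have : {s : ℂ | 1 < s.re} ∈ 𝓝 (2 : ℂ) :=
      (isOpen_lt continuous_const Complex.continuous_re).mem_nhds (by simp)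
    filter_upwards [this] with w hw
    exact (zterm_hasSum hw).tsum_eq.symm

lemma zeta1_bound {ε : ℝ} (h0 : 0 < ε) (h1 : ε ≤ 1 / 2) :
    ∃ C : ℝ, 0 < C ∧ ∀ s : ℂ, 1 - ε ≤ s.re → ‖riemannZeta₁ s - 1‖ ≤ ‖s - 1‖ * (C * ‖s‖ ^ (2 * ε)) := by
  have hS := summable_succ_rpow (a := -1 - ε) (by linarith)
  refine ⟨2 * ∑' n : ℕ, (n + 1 : ℝ) ^ (-1 - ε), ?_, ?_⟩
  · have : 0 < ∑' n : ℕ, (n + 1 : ℝ) ^ (-1 - ε) :=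
      hS.tsum_pos (fun n => by positivity) 0 (by positivity)
    linarith
  · intro s hs
    rw [zeta1_eq_tsum (by linarith)]
    refine (tsum_of_norm_bounded (g := fun n : ℕ => ‖s - 1‖ * (2 * ‖s‖ ^ (2 * ε)) * (n + 1 : ℝ) ^ (-1 - ε))
      (hS.hasSum.mul_left _) ?_).trans ?_
    · intro n
      refine (zterm_bound n (by linarith) (θ := 2 * ε) (by linarith) (by linarith)).trans ?_
      rw [mul_assoc ‖s - 1‖]
      have := Real.rpow_le_rpow_of_exponent_le (x := (n + 1 : ℝ)) (y := -s.re - 2 * ε) (z := -1 - ε)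
        (by linarith [(n.cast_nonneg : (0 : ℝ) ≤ n)]) (by linarith)
      gcongr
    · apply le_of_eq; ring

/-- `ζ` is bounded by a small power of `|s|` near the line `Re s = 1`. -/
lemma zeta_bound {ε : ℝ} (h0 : 0 < ε) (h1 : ε ≤ 1 / 2) :
    ∃ C : ℝ, 0 < C ∧ ∀ s : ℂ, s ≠ 1 → 1 - ε ≤ s.re → ‖riemannZeta s‖ ≤ ‖s - 1‖⁻¹ + C * ‖s‖ ^ (2 * ε) := by
  obtain ⟨C, hC, h⟩ := zeta1_bound h0 h1
  refine ⟨C, hC, fun s hs1 hs => ?_⟩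
  have hp : 0 < ‖s - 1‖ := norm_pos_iff.mpr (sub_ne_zero.mpr hs1)
  rw [riemannZeta_eq_inv_sub_mul hs1, norm_mul, norm_inv]
  have : ‖riemannZeta₁ s‖ ≤ 1 + ‖s - 1‖ * (C * ‖s‖ ^ (2 * ε)) := by
    calc ‖riemannZeta₁ s‖ = ‖1 + (riemannZeta₁ s - 1)‖ := by congr 1; ring
      _ ≤ ‖(1 : ℂ)‖ + ‖riemannZeta₁ s - 1‖ := norm_add_le _ _
      _ ≤ _ := by rw [norm_one]; linarith [h s hs]
  calc ‖s - 1‖⁻¹ * ‖riemannZeta₁ s‖ ≤ ‖s - 1‖⁻¹ * (1 + ‖s - 1‖ * (C * ‖s‖ ^ (2 * ε))) := by gcongr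
    _ = _ := by field_simp


lemma zeta_strip {β : ℝ} (h0 : 0 < β) (h1 : β ≤ 1) :
    ∃ C : ℝ, 0 < C ∧ ∀ s : ℂ, 1 - β / 2 ≤ s.re → s.re ≤ 4 → 1 / 2 ≤ |s.im| →
      ‖riemannZeta s‖ ≤ C * |s.im| ^ β := by
  obtain ⟨C, hC, h⟩ := zeta_bound (ε := β / 2) (by linarith) (by linarith)
  refine ⟨4 + 9 * C, by positivity, fun s hs1 hs2 hs3 => ?_⟩
  have hne : s ≠ 1 := by
    rintro rfl
    norm_num at hs3
  refine (h s hne hs1).trans ?_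
  have e1 : |s.im| ≤ ‖s - 1‖ := by simpa using Complex.abs_im_le_norm (s - 1)
  have e2 : ‖s - 1‖⁻¹ ≤ 2 := by
    rw [inv_le_comm₀ (by linarith) (by norm_num)]; linarith
  have e3 : (1 / 2 : ℝ) ≤ |s.im| ^ β := by
    calc (1 / 2 : ℝ) = (1 / 2) ^ (1 : ℝ) := by simp
      _ ≤ (1 / 2) ^ β := Real.rpow_le_rpow_of_exponent_ge (by norm_num) (by norm_num) h1
      _ ≤ _ := by gcongr
  have e4 : ‖s‖ ≤ 9 * |s.im| := by
    refine (Complex.norm_le_abs_re_add_abs_im s).trans ?_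
    have : |s.re| ≤ 4 := by rw [abs_le]; constructor <;> linarith
    linarith
  have e5 : ‖s‖ ^ (2 * (β / 2)) ≤ 9 * |s.im| ^ β := by
    rw [show 2 * (β / 2) = β by ring]
    calc ‖s‖ ^ β ≤ (9 * |s.im|) ^ β := by gcongr
      _ = 9 ^ β * |s.im| ^ β := Real.mul_rpow (by norm_num) (abs_nonneg _)
      _ ≤ 9 * |s.im| ^ β := by
        gcongr
        calc (9 : ℝ) ^ β ≤ 9 ^ (1 : ℝ) := Real.rpow_le_rpow_of_exponent_le (by norm_num) h1
          _ = 9 := by simp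
  nlinarith

lemma zeta_deriv_strip {β : ℝ} (h0 : 0 < β) (h1 : β ≤ 1) :
    ∃ C : ℝ, 0 < C ∧ ∀ s : ℂ, 1 - β / 4 ≤ s.re → s.re ≤ 3 → 1 ≤ |s.im| →
      ‖deriv riemannZeta s‖ ≤ C * |s.im| ^ β := by
  obtain ⟨C, hC, h⟩ := zeta_strip h0 h1
  refine ⟨2 * C / (β / 4), by positivity, fun s hs1 hs2 hs3 => ?_⟩
  have key : ∀ z ∈ Metric.closedBall s (β / 4), 1 - β / 2 ≤ z.re ∧ z.re ≤ 4 ∧ 1 / 2 ≤ |z.im| ∧ |z.im| ≤ 2 * |s.im| := by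
    intro z hz
    rw [Metric.mem_closedBall, dist_eq_norm] at hz
    have a1 := (Complex.abs_re_le_norm (z - s)).trans hz
    have a2 := (Complex.abs_im_le_norm (z - s)).trans hz
    simp only [sub_re, sub_im] at a1 a2
    have a3 := (abs_le.mp a1)
    have b1 := abs_sub_abs_le_abs_sub z.im s.im
    have b2 := abs_sub_abs_le_abs_sub s.im z.im
    rw [abs_sub_comm] at b2
    refine ⟨by linarith, by linarith, by linarith, by linarith⟩
  have := Complex.norm_deriv_le_of_forall_mem_sphere_norm_le (f := riemannZeta) (c := s) (R := β / 4)
    (C := 2 * C * |s.im| ^ β) (by positivity) ?_ ?_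
  · refine this.trans (le_of_eq ?_); ring
  · apply DifferentiableOn.diffContOnCl
    intro z hz
    rw [closure_ball _ (by positivity)] at hz
    apply DifferentiableAt.differentiableWithinAt
    apply differentiableAt_riemannZeta
    rintro rfl
    have := (key 1 hz).2.2.1
    norm_num at this
  · intro z hz
    have hz := key z (Metric.sphere_subset_closedBall hz)
    refine (h z hz.1 hz.2.1 hz.2.2.1).trans ?_
    calc C * |z.im| ^ β ≤ C * (2 * |s.im|) ^ β := by gcongr; exact hz.2.2.2
      _ = C * (2 ^ β * |s.im| ^ β) := by rw [Real.mul_rpow (by norm_num) (abs_nonneg _)]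
      _ ≤ C * (2 * |s.im| ^ β) := by
        gcongr
        calc (2 : ℝ) ^ β ≤ 2 ^ (1 : ℝ) := Real.rpow_le_rpow_of_exponent_le (by norm_num) h1
          _ = 2 := by simp
      _ = _ := by ring

lemma zeta_341 {x : ℝ} (hx : 0 < x) (y : ℝ) :
    1 ≤ ‖riemannZeta (1 + x)‖ ^ 3 * ‖riemannZeta (1 + x + I * y)‖ ^ 4 * ‖riemannZeta (1 + x + 2 * I * y)‖ := by
  have := DirichletCharacter.norm_LFunction_product_ge_one (N := 1) 1 hx y
  rw [DirichletCharacter.LFunctionTrivChar] at this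
  simp only [DirichletCharacter.LFunction_modOne_eq] at this
  simpa only [norm_mul, norm_pow] using this

lemma zeta_lower1 {β : ℝ} (h0 : 0 < β) (h1 : β ≤ 1) :
    ∃ c : ℝ, 0 < c ∧ ∀ x y : ℝ, 0 < x → x ≤ 2 → 1 ≤ |y| →
      c * x ^ 3 * |y| ^ (-β) ≤ ‖riemannZeta (1 + x + I * y)‖ ^ 4 := by
  obtain ⟨C, hC, h⟩ := zeta_strip h0 h1
  obtain ⟨D, hD, hd⟩ := zeta_bound (ε := 1 / 2) (by norm_num) (by norm_num)
  refine ⟨((1 + 6 * D) ^ 3 * (2 * C))⁻¹, by positivity, fun x y hx hx2 hy => ?_⟩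
  have a1 : ‖riemannZeta (1 + x)‖ ≤ (1 + 6 * D) / x := by
    have := hd (1 + x) (by intro h; simp at h; linarith) (by simp; linarith)
    refine this.trans ?_
    have e : ‖(1 + x : ℂ)‖ = 1 + x := by
      rw [show (1 + x : ℂ) = ((1 + x : ℝ) : ℂ) by push_cast; rfl, Complex.norm_real, Real.norm_eq_abs, abs_of_pos (by linarith)]
    rw [e]
    simp only [add_sub_cancel_left, Complex.norm_real, Real.norm_eq_abs, abs_of_pos hx]
    norm_num
    rw [le_div_iff₀ hx, add_mul, inv_mul_cancel₀ hx.ne']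
    nlinarith [mul_pos hD hx, mul_nonneg hD.le (mul_nonneg hx.le (sub_nonneg.mpr hx2))]
  have hy0 : 0 < |y| := by linarith
  have a2 : ‖riemannZeta (1 + x + 2 * I * y)‖ ≤ 2 * C * |y| ^ β := by
    have := h (1 + x + 2 * I * y) (by simp; linarith) (by simp; linarith) (by simp [abs_mul]; linarith)
    refine this.trans ?_
    have e : ((1 : ℂ) + x + 2 * I * y).im = 2 * y := by simp
    rw [e, abs_mul, Real.mul_rpow (by norm_num) (abs_nonneg _)]
    have : |(2 : ℝ)| ^ β ≤ 2 := by
      calc |(2 : ℝ)| ^ β ≤ 2 ^ (1 : ℝ) := by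
            rw [abs_two]; exact Real.rpow_le_rpow_of_exponent_le (by norm_num) h1
          _ = 2 := by simp
    have h3 : 0 < |y| ^ β := by positivity
    nlinarith [mul_pos hC h3]
  have key := zeta_341 hx y
  set Z := ‖riemannZeta (1 + x + I * y)‖ ^ 4
  have hZ : 0 ≤ Z := by positivity
  have : 1 ≤ ((1 + 6 * D) / x) ^ 3 * Z * (2 * C * |y| ^ β) := by
    refine key.trans ?_
    gcongr
  rw [Real.rpow_neg hy0.le]
  have h3 : 0 < |y| ^ β := by positivity
  rw [← div_eq_mul_inv, div_le_iff₀ h3, inv_mul_le_iff₀ (by positivity)]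
  rw [div_pow] at this
  have h4 : x ^ 3 * 1 ≤ x ^ 3 * ((1 + 6 * D) ^ 3 / x ^ 3 * Z * (2 * C * |y| ^ β)) := by gcongr
  refine (mul_one (x ^ 3)).symm.le.trans (h4.trans (le_of_eq ?_))
  field_simp

lemma zeta_lower {β : ℝ} (h0 : 0 < β) (h1 : β ≤ 1) :
    ∃ κ c : ℝ, 0 < κ ∧ κ ≤ β / 4 ∧ 0 < c ∧ ∀ s : ℂ, 1 ≤ |s.im| → 1 - κ * |s.im| ^ (-(5 * β)) ≤ s.re →
      s.re ≤ 3 → c * |s.im| ^ (-(4 * β)) ≤ ‖riemannZeta s‖ := by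
  obtain ⟨c, hc, hlow⟩ := zeta_lower1 h0 h1
  obtain ⟨D, hD, hder⟩ := zeta_deriv_strip h0 h1
  set κ := min (β / 4) (c / (4 * D) ^ 4) with hκ
  have hκ0 : 0 < κ := lt_min (by positivity) (by positivity)
  have hκ1 : κ ≤ β / 4 := min_le_left _ _
  have hκ2 : κ * (4 * D) ^ 4 ≤ c := (le_div_iff₀ (by positivity)).mp (min_le_right _ _)
  refine ⟨κ, 2 * D * κ, hκ0, hκ1, by positivity, fun s hs1 hs2 hs3 => ?_⟩
  set τ := |s.im| with hτ
  have hτ0 : 0 < τ := by linarith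
  set x := κ * τ ^ (-(5 * β)) with hx
  have hx0 : 0 < x := by positivity
  have hτle : τ ^ (-(5 * β)) ≤ 1 := Real.rpow_le_one_of_one_le_of_nonpos hs1 (by linarith)
  have hxκ : x ≤ κ := by
    rw [hx]; nlinarith
  have hlow2 : ∀ x' : ℝ, x ≤ x' → x' ≤ 2 → 4 * D * κ * τ ^ (-(4 * β)) ≤ ‖riemannZeta (1 + x' + I * s.im)‖ := by
    intro x' hx' hx'2
    have := hlow x' s.im (by linarith) hx'2 hs1
    refine le_of_pow_le_pow_left₀ (n := 4) (by norm_num) (norm_nonneg _) (le_trans ?_ this)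
    have e : (τ ^ (-(4 * β))) ^ 4 = (τ ^ (-(5 * β))) ^ 3 * τ ^ (-β) := by
      rw [← Real.rpow_natCast, ← Real.rpow_natCast, ← Real.rpow_mul hτ0.le, ← Real.rpow_mul hτ0.le, ← Real.rpow_add hτ0]
      congr 1; push_cast; ring
    calc (4 * D * κ * τ ^ (-(4 * β))) ^ 4 = (κ * (4 * D) ^ 4) * (κ ^ 3 * (τ ^ (-(4 * β))) ^ 4) := by ring
      _ ≤ c * (κ ^ 3 * (τ ^ (-(4 * β))) ^ 4) := by gcongr
      _ = c * x ^ 3 * τ ^ (-β) := by rw [e, hx]; ring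
      _ ≤ _ := by gcongr
  have hpos : 0 < D * κ * τ ^ (-(4 * β)) := by positivity
  by_cases hbig : 1 + x ≤ s.re
  · have := hlow2 (s.re - 1) (by linarith) (by linarith)
    have e : (1 + ((s.re - 1 : ℝ) : ℂ) + I * s.im) = s := by
      apply Complex.ext <;> simp
    rw [e] at this
    linarith
  · have := hlow2 x le_rfl (by linarith)
    set w : ℂ := 1 + x + I * s.im with hw
    have hwim : w.im = s.im := by simp [hw]
    have hwre : w.re = 1 + x := by simp [hw]
    -- mean value along the horizontal segment
    have hmv := Convex.norm_image_sub_le_of_norm_deriv_le (f := riemannZeta) (s := segment ℝ s w) (x := s) (y := w)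
      (C := D * τ ^ β) ?_ ?_ (convex_segment s w) (left_mem_segment ℝ s w) (right_mem_segment ℝ s w)
    · have e1 : ‖w - s‖ ≤ 2 * x := by
        have : w - s = ((1 + x - s.re : ℝ) : ℂ) := by
          apply Complex.ext <;> simp [hwre, hwim]
        rw [this, Complex.norm_real, Real.norm_eq_abs, abs_le]
        constructor <;> linarith
      have e2 : D * τ ^ β * ‖w - s‖ ≤ 2 * (D * κ * τ ^ (-(4 * β))) := by
        calc D * τ ^ β * ‖w - s‖ ≤ D * τ ^ β * (2 * x) := by gcongr
          _ = 2 * (D * κ * (τ ^ β * τ ^ (-(5 * β)))) := by rw [hx]; ring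
          _ = _ := by rw [← Real.rpow_add hτ0]; congr 3; ring
      have e3 := norm_sub_norm_le (riemannZeta w) (riemannZeta s)
      linarith
    · intro z hz
      obtain ⟨a, b, ha, hb, hab, rfl⟩ := hz
      apply differentiableAt_riemannZeta
      intro h
      have : (a • s + b • w).im = s.im := by
        simp [hwim, ← add_mul, hab]
      rw [h] at this
      simp at this
      rw [hτ, ← this] at hs1
      norm_num at hs1
    · intro z hz
      obtain ⟨a, b, ha, hb, hab, rfl⟩ := hz
      have him : (a • s + b • w).im = s.im := by
        simp [hwim, ← add_mul, hab]
      have hre : (a • s + b • w).re = a * s.re + b * (1 + x) := by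
        simp [hwre]
      have := hder (a • s + b • w) ?_ ?_ ?_
      · rwa [him] at this
      · rw [hre]
        have : a = 1 - b := by linarith
        subst this
        nlinarith
      · rw [hre]
        have : a = 1 - b := by linarith
        subst this
        nlinarith
      · rw [him]; exact hs1

/-- The negative logarithmic derivative of zeta minus zeta. -/
noncomputable def zF (s : ℂ) : ℂ := -deriv riemannZeta s / riemannZeta s - riemannZeta s

lemma zF_bound {β : ℝ} (h0 : 0 < β) (h1 : β ≤ 1) :
    ∃ κ C : ℝ, 0 < κ ∧ κ ≤ 1 ∧ 0 < C ∧ ∀ s : ℂ, 1 ≤ |s.im| → 1 - κ * |s.im| ^ (-(5 * β)) ≤ s.re →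
      s.re ≤ 3 → riemannZeta s ≠ 0 ∧ ‖zF s‖ ≤ C * |s.im| ^ (5 * β) := by
  obtain ⟨κ, c, hκ, hκ1, hc, hlow⟩ := zeta_lower h0 h1
  obtain ⟨D, hD, hder⟩ := zeta_deriv_strip h0 h1
  obtain ⟨E, hE, hE2⟩ := zeta_strip h0 h1
  refine ⟨κ, D / c + E, hκ, by linarith, by positivity, fun s hs1 hs2 hs3 => ?_⟩
  have hτ0 : 0 < |s.im| := by linarith
  have hτle : |s.im| ^ (-(5 * β)) ≤ 1 := Real.rpow_le_one_of_one_le_of_nonpos hs1 (by linarith)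
  have hre : 1 - β / 4 ≤ s.re := by nlinarith
  have hl := hlow s hs1 hs2 hs3
  have hlp : 0 < c * |s.im| ^ (-(4 * β)) := by positivity
  have hne : riemannZeta s ≠ 0 := norm_pos_iff.mp (hlp.trans_le hl)
  refine ⟨hne, ?_⟩
  unfold zF
  refine (norm_sub_le _ _).trans ?_
  rw [norm_div, norm_neg, add_mul]
  have e1 : ‖deriv riemannZeta s‖ / ‖riemannZeta s‖ ≤ D / c * |s.im| ^ (5 * β) := by
    calc _ ≤ (D * |s.im| ^ β) / (c * |s.im| ^ (-(4 * β))) := by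
          gcongr
          exact hder s hre hs3 hs1
      _ = D / c * (|s.im| ^ β / |s.im| ^ (-(4 * β))) := by ring
      _ = _ := by rw [← Real.rpow_sub hτ0]; congr 2; ring
  have e2 : ‖riemannZeta s‖ ≤ E * |s.im| ^ (5 * β) := by
    refine (hE2 s (by linarith) (by linarith) (by linarith)).trans ?_
    gcongr
    linarith
  linarith

lemma zF_iteratedDeriv_bound_large (k : ℕ) :
    ∃ C : ℝ, 0 < C ∧ ∀ s : ℂ, 2 ≤ |s.im| → 1 < s.re → s.re ≤ 2 →
      ‖iteratedDeriv k zF s‖ ≤ C * |s.im| := by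
  set β : ℝ := 1 / (5 * (k + 1)) with hβ
  have h0 : 0 < β := by positivity
  have h1 : β ≤ 1 := by
    rw [hβ, div_le_one (by positivity)]
    have : (0 : ℝ) ≤ k := k.cast_nonneg
    linarith
  obtain ⟨κ, C, hκ, hκ1, hC, hF⟩ := zF_bound h0 h1
  refine ⟨k.factorial * C / κ ^ k * 2, by positivity, fun s hs1 hs2 hs3 => ?_⟩
  set τ := |s.im| with hτ
  have hτ0 : 0 < τ := by linarith
  set r := κ * (2 * τ) ^ (-(5 * β)) with hr
  have hr0 : 0 < r := by positivity
  have hle : (2 * τ) ^ (-(5 * β)) ≤ 1 := Real.rpow_le_one_of_one_le_of_nonpos (by linarith) (by linarith)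
  have hr1 : r ≤ 1 := by rw [hr]; nlinarith
  have key : ∀ z ∈ Metric.closedBall s r, 1 ≤ |z.im| ∧ |z.im| ≤ 2 * τ ∧ 1 - κ * |z.im| ^ (-(5 * β)) ≤ z.re ∧ z.re ≤ 3 := by
    intro z hz
    rw [Metric.mem_closedBall, dist_eq_norm] at hz
    have a1 := (Complex.abs_re_le_norm (z - s)).trans hz
    have a2 := (Complex.abs_im_le_norm (z - s)).trans hz
    simp only [sub_re, sub_im] at a1 a2
    have a3 := (abs_le.mp a1)
    have b1 := abs_sub_abs_le_abs_sub z.im s.im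
    have b2 := abs_sub_abs_le_abs_sub s.im z.im
    rw [abs_sub_comm] at b2
    have c1 : 1 ≤ |z.im| := by linarith
    have c2 : |z.im| ≤ 2 * τ := by linarith
    refine ⟨c1, c2, ?_, by linarith⟩
    have : (2 * τ) ^ (-(5 * β)) ≤ |z.im| ^ (-(5 * β)) :=
      Real.rpow_le_rpow_of_nonpos (by linarith) c2 (by linarith)
    have : r ≤ κ * |z.im| ^ (-(5 * β)) := by rw [hr]; gcongr
    linarith
  have := Complex.norm_iteratedDeriv_le_of_forall_mem_sphere_norm_le (f := zF) (c := s) (R := r)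
    (C := C * (2 * τ) ^ (5 * β)) k hr0 ?_ ?_
  · refine this.trans (le_of_eq ?_)
    rw [hr, mul_pow, ← Real.rpow_natCast ((2 * τ) ^ (-(5 * β))), ← Real.rpow_mul (by positivity)]
    have e : (2 * τ) ^ (5 * β) = 2 * τ * (2 * τ) ^ (-(5 * β) * k) := by
      nth_rewrite 2 [← Real.rpow_one (2 * τ)]
      rw [← Real.rpow_add (by positivity)]
      congr 1
      rw [hβ]; field_simp; ring
    rw [e]
    have : (2 * τ) ^ (-(5 * β) * k) ≠ 0 := by positivity
    field_simp
  · apply DifferentiableOn.diffContOnCl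
    intro z hz
    rw [closure_ball _ hr0.ne'] at hz
    have hz := key z hz
    have hne1 : z ≠ 1 := by
      rintro rfl
      have := hz.1
      norm_num at this
    have hd := differentiableAt_riemannZeta hne1
    have hd2 : DifferentiableAt ℂ (deriv riemannZeta) z := by
      have hA : AnalyticAt ℂ riemannZeta z := by
        have : DifferentiableOn ℂ riemannZeta {1}ᶜ := fun w hw => (differentiableAt_riemannZeta hw).differentiableWithinAt
        exact this.analyticAt (isOpen_compl_singleton.mem_nhds hne1)
      exact hA.deriv.differentiableAt
    apply DifferentiableAt.differentiableWithinAt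
    unfold zF
    exact (hd2.neg.div hd (hF z hz.1 hz.2.2.1 hz.2.2.2).1).sub hd
  · intro z hz
    have hz := key z (Metric.sphere_subset_closedBall hz)
    refine (hF z hz.1 hz.2.2.1 hz.2.2.2).2.trans ?_
    gcongr
    exact hz.2.1

/-- analytic continuation of `zF` through `s = 1` -/
noncomputable def zF' (s : ℂ) : ℂ := -deriv riemannZeta₁ s / riemannZeta₁ s - riemannZeta₀ s

lemma zF_eq {s : ℂ} (hs : 1 < s.re) : zF s = zF' s := by
  have h1 : s ≠ 1 := by rintro rfl; simp at hs
  have h2 : s - 1 ≠ 0 := sub_ne_zero.mpr h1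
  have hz : riemannZeta s ≠ 0 := riemannZeta_ne_zero_of_one_lt_re hs
  unfold zF zF'
  rw [deriv_riemannZeta_eq_neg_inv_sub_sq_mul_add h1]
  have e := riemannZeta_eq_inv_sub_mul h1
  have e2 := riemannZeta_eq_inv_sub_add h1
  have hz1 : riemannZeta₁ s ≠ 0 := by
    intro h; rw [h] at e; simp at e; exact hz e
  rw [e2, sub_add_eq_sub_sub, sub_left_inj, ← e2, e]
  field_simp
  ring

lemma zF_iteratedDeriv_bound_small (k : ℕ) :
    ∃ C : ℝ, 0 < C ∧ ∀ s : ℂ, |s.im| ≤ 2 → 1 < s.re → s.re ≤ 2 →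
      ‖iteratedDeriv k zF s‖ ≤ C := by
  set K : Set ℂ := Set.Icc 1 2 ×ℂ Set.Icc (-2) 2 with hK
  have hKc : IsCompact K := isCompact_Icc.reProdIm isCompact_Icc
  have hA : ∀ s ∈ K, AnalyticAt ℂ zF' s := by
    intro s hs
    have h1 : riemannZeta₁ s ≠ 0 := by
      by_cases h : s = 1
      · subst h; simp
      · intro h2
        have := riemannZeta_eq_inv_sub_mul h
        rw [h2, mul_zero] at this
        exact riemannZeta_ne_zero_of_one_le_re hs.1.1 this
    have a1 : AnalyticAt ℂ riemannZeta₁ s := differentiable_riemannZeta₁.analyticAt s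
    exact (a1.deriv.neg.div a1 h1).sub (differentiable_riemannZeta₀.analyticAt s)
  have hc : ContinuousOn (iteratedDeriv k zF') K := fun s hs =>
    ((hA s hs).iterated_deriv k |>.continuousAt.continuousWithinAt.congr (fun _ _ => by rw [iteratedDeriv_eq_iterate]) (by rw [iteratedDeriv_eq_iterate]))
  obtain ⟨C, hC⟩ := hKc.exists_bound_of_continuousOn hc
  refine ⟨max C 1, by positivity, fun s h1 h2 h3 => ?_⟩
  have e : zF =ᶠ[𝓝 s] zF' := by
    have : {s : ℂ | 1 < s.re} ∈ 𝓝 s :=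
      (isOpen_lt continuous_const Complex.continuous_re).mem_nhds h2
    filter_upwards [this] with w hw using zF_eq hw
  rw [e.iteratedDeriv_eq k]
  exact (hC s ⟨⟨h2.le, h3⟩, abs_le.mp h1⟩).trans (le_max_left _ _)

lemma zF_iteratedDeriv_bound (k : ℕ) :
    ∃ C : ℝ, 0 < C ∧ ∀ s : ℂ, 1 < s.re → s.re ≤ 2 →
      ‖iteratedDeriv k zF s‖ ≤ C * (1 + |s.im|) := by
  obtain ⟨C, hC, h⟩ := zF_iteratedDeriv_bound_large k
  obtain ⟨D, hD, h'⟩ := zF_iteratedDeriv_bound_small k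
  refine ⟨C + D, by positivity, fun s h1 h2 => ?_⟩
  have := abs_nonneg s.im
  rcases le_total 2 |s.im| with h3 | h3
  · have := h s h3 h1 h2
    nlinarith
  · have := h' s h3 h1 h2
    nlinarith


open FourierTransform in
lemma bump_exists : ∃ (φ : ℝ → ℝ) (g : ℝ → ℂ), Integrable g ∧ Integrable (fun ξ => |ξ| * ‖g ξ‖) ∧
    (∀ v, 0 ≤ φ v) ∧ (∀ v, φ v ≤ 1) ∧ (∀ v, |v| ≤ 1/2 → φ v = 1) ∧
    (∀ v, 1 ≤ |v| → φ v = 0) ∧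
    ∀ v : ℝ, (φ v : ℂ) = ∫ ξ : ℝ, cexp (((2 * Real.pi * (ξ * v) : ℝ) : ℂ) * I) * g ξ := by
  let φ : ContDiffBump (0 : ℝ) := ⟨1/2, 1, by norm_num, by norm_num⟩
  have hc : HasCompactSupport (fun x => ((φ x : ℝ) : ℂ)) :=
    φ.hasCompactSupport.comp_left (g := fun x : ℝ => (x : ℂ)) (by simp)
  have hd : ContDiff ℝ (⊤ : ℕ∞) (fun x => ((φ x : ℝ) : ℂ)) :=
    Complex.ofRealCLM.contDiff.comp φ.contDiff
  let f : SchwartzMap ℝ ℂ := hc.toSchwartzMap hd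
  have hf : ∀ x, f x = ((φ x : ℝ) : ℂ) := fun x => rfl
  let g : SchwartzMap ℝ ℂ := 𝓕 f
  refine ⟨φ, g, g.integrable, ?_, fun v => φ.nonneg, fun v => φ.le_one, ?_, ?_, ?_⟩
  · simpa using g.integrable_pow_mul volume 1
  · intro v hv
    exact φ.one_of_mem_closedBall (by simpa [φ] using hv)
  · intro v hv
    exact φ.zero_of_le_dist (by simpa [φ] using hv)
  · intro v
    have h1 : 𝓕⁻ g = f := by simp [g]
    have h2 := SchwartzMap.fourierInv_coe g
    rw [h1] at h2
    rw [← hf, h2, Real.fourierInv_eq']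
    refine integral_congr_ae (Eventually.of_forall fun ξ => ?_)
    simp [mul_comm]

noncomputable def aSeq (n : ℕ) : ℂ := (ArithmeticFunction.vonMangoldt n : ℂ) - 1

lemma aSeq_summable {s : ℂ} (hs : 1 < s.re) : LSeriesSummable aSeq s := by
  have h1 := ArithmeticFunction.LSeriesSummable_vonMangoldt hs
  have h2 : LSeriesSummable (1 : ℕ → ℂ) s := LSeriesSummable_one_iff.mpr hs
  exact h1.sub h2

lemma aSeq_abscissa : LSeries.abscissaOfAbsConv aSeq ≤ 1 := by
  have := LSeries.abscissaOfAbsConv_le_of_forall_lt_LSeriesSummable (f := aSeq) (x := 1)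
    (fun y hy => aSeq_summable (by simpa using hy))
  exact_mod_cast this

lemma aSeq_LSeries {s : ℂ} (hs : 1 < s.re) : LSeries aSeq s = zF s := by
  have h1 := ArithmeticFunction.LSeriesSummable_vonMangoldt hs
  have h2 : LSeriesSummable (1 : ℕ → ℂ) s := LSeriesSummable_one_iff.mpr hs
  have h3 := LSeries_sub h1 h2
  rw [ArithmeticFunction.LSeries_vonMangoldt_eq_deriv_riemannZeta_div hs,
    LSeries_one_eq_riemannZeta hs] at h3
  exact h3

noncomputable def bSeq (k : ℕ) : ℕ → ℂ := LSeries.logMul^[k] aSeq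

lemma bSeq_apply (k n : ℕ) : bSeq k n = ((Real.log n : ℝ) : ℂ) ^ k * aSeq n := by
  induction k with
  | zero => simp [bSeq]
  | succ k ih =>
    unfold bSeq at *
    rw [Function.iterate_succ_apply', LSeries.logMul, ih, pow_succ, Complex.natCast_log]
    ring

lemma aSeq_lt {s : ℂ} (hs : 1 < s.re) : LSeries.abscissaOfAbsConv aSeq < s.re :=
  lt_of_le_of_lt aSeq_abscissa (by exact_mod_cast hs)

lemma bSeq_summable (k : ℕ) {s : ℂ} (hs : 1 < s.re) : LSeriesSummable (bSeq k) s := by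
  apply LSeriesSummable_of_abscissaOfAbsConv_lt_re
  unfold bSeq
  rw [LSeries.absicssaOfAbsConv_logPowMul]
  exact aSeq_lt hs

lemma bSeq_bound (k : ℕ) : ∃ C, 0 < C ∧ ∀ s : ℂ, 1 < s.re → s.re ≤ 2 →
    ‖LSeries (bSeq k) s‖ ≤ C * (1 + |s.im|) := by
  obtain ⟨C, hC, h⟩ := zF_iteratedDeriv_bound k
  refine ⟨C, hC, fun s h1 h2 => ?_⟩
  have h3 := LSeries_iteratedDeriv (f := aSeq) k (aSeq_lt h1)
  have h4 : iteratedDeriv k (LSeries aSeq) s = iteratedDeriv k zF s := by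
    apply Filter.EventuallyEq.iteratedDeriv_eq
    filter_upwards [(isOpen_lt continuous_const Complex.continuous_re).mem_nhds h1] with z hz
    exact aSeq_LSeries hz
  rw [h4] at h3
  have := h s h1 h2
  rw [h3, norm_mul, norm_pow, norm_neg, norm_one, one_pow, one_mul] at this
  exact this

lemma bSeq_term (k : ℕ) (σ τ : ℝ) (n : ℕ) :
    LSeries.term (bSeq k) ((σ : ℂ) - τ * I) n =
      LSeries.term (bSeq k) σ n * cexp (((τ * Real.log n : ℝ) : ℂ) * I) := by
  rcases eq_or_ne n 0 with rfl | hn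
  · simp
  have hn' : (n : ℂ) ≠ 0 := by exact_mod_cast hn
  rw [LSeries.term_of_ne_zero hn, LSeries.term_of_ne_zero hn, cpow_sub _ _ hn',
    cpow_def_of_ne_zero hn' (τ * I), ← natCast_log]
  have : cexp (((τ * Real.log n : ℝ) : ℂ) * I) = cexp ((Real.log n : ℂ) * (τ * I)) := by
    push_cast; ring_nf
  rw [this]
  field_simp

lemma smooth_bound (k : ℕ) : ∃ φ : ℝ → ℝ, 
    (∀ v, 0 ≤ φ v) ∧ (∀ v, φ v ≤ 1) ∧ (∀ v, |v| ≤ 1/2 → φ v = 1) ∧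
    (∀ v, 1 ≤ |v| → φ v = 0) ∧ ∃ C, 0 < C ∧ ∀ σ η L : ℝ, 1 < σ → σ ≤ 2 → 0 < η → η ≤ 1 →
    ‖∑' n, LSeries.term (bSeq k) σ n * (φ ((Real.log n - L) / η) : ℂ)‖ ≤ C / η := by
  obtain ⟨φ, g, hg, hg1, h0, h1, h2, h3, h4⟩ := bump_exists
  refine ⟨φ, h0, h1, h2, h3, ?_⟩
  obtain ⟨C, hC, hb⟩ := bSeq_bound k
  set A := ∫ ξ, ‖g ξ‖
  set B := ∫ ξ, |ξ| * ‖g ξ‖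
  have hA : 0 ≤ A := integral_nonneg fun _ => norm_nonneg _
  have hB : 0 ≤ B := integral_nonneg fun _ => by positivity
  refine ⟨C * (A + 2 * Real.pi * B) + 1, by positivity, fun σ η L hσ hσ2 hη hη1 => ?_⟩
  let F : ℕ → ℝ → ℂ := fun n ξ => LSeries.term (bSeq k) σ n *
    (cexp (((2 * Real.pi * (ξ * ((Real.log n - L) / η)) : ℝ) : ℂ) * I) * g ξ)
  have hFn : ∀ n ξ, ‖F n ξ‖ = ‖LSeries.term (bSeq k) σ n‖ * ‖g ξ‖ := by
    intro n ξ
    simp only [F, norm_mul, Complex.norm_exp_ofReal_mul_I, one_mul]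
  have hFi : ∀ n, Integrable (F n) := by
    intro n
    refine (hg.bdd_mul (c := 1) ?_ ?_).const_mul _
    · exact (by fun_prop : Continuous _).aestronglyMeasurable
    · exact Eventually.of_forall fun ξ => (Complex.norm_exp_ofReal_mul_I _).le
  have hs : 1 < ((σ : ℂ)).re := by simpa using hσ
  have hFs : Summable fun n => ∫ ξ, ‖F n ξ‖ := by
    simp_rw [hFn, integral_const_mul]
    exact (bSeq_summable k hs).norm.mul_right _
  have h5 := hasSum_integral_of_summable_integral_norm hFi hFs
  have h6 : ∀ n, ∫ ξ, F n ξ = LSeries.term (bSeq k) σ n * (φ ((Real.log n - L) / η) : ℂ) := by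
    intro n
    rw [h4, ← integral_const_mul]
  simp_rw [h6] at h5
  rw [h5.tsum_eq]
  have h7 : ∀ ξ, ‖∑' n, F n ξ‖ ≤ C * (‖g ξ‖ + 2 * Real.pi / η * (|ξ| * ‖g ξ‖)) := by
    intro ξ
    have : ∀ n, F n ξ = LSeries.term (bSeq k) ((σ : ℂ) - ((2 * Real.pi * ξ / η : ℝ) : ℂ) * I) n *
       (cexp (((- (2 * Real.pi * ξ / η * L) : ℝ) : ℂ) * I) * g ξ) := by
      intro n
      rw [bSeq_term]
      simp only [F]
      rw [mul_assoc (LSeries.term _ _ _), ← mul_assoc (cexp _) (cexp _), ← Complex.exp_add]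
      congr 3
      push_cast
      ring_nf
    simp_rw [this]
    rw [tsum_mul_right, norm_mul, norm_mul, Complex.norm_exp_ofReal_mul_I, one_mul]
    have h8 := hb ((σ : ℂ) - ((2 * Real.pi * ξ / η : ℝ) : ℂ) * I) (by simpa using hσ)
      (by simpa using hσ2)
    have h9 : ((σ : ℂ) - ((2 * Real.pi * ξ / η : ℝ) : ℂ) * I).im = -(2 * Real.pi * ξ / η) := by
      simp
    rw [h9, abs_neg, abs_div, abs_mul, abs_mul, abs_of_pos hη, abs_of_pos Real.pi_pos, abs_two] at h8
    calc _ ≤ (C * (1 + 2 * Real.pi * |ξ| / η)) * ‖g ξ‖ := by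
          exact mul_le_mul_of_nonneg_right h8 (norm_nonneg _)
      _ = _ := by ring
  have hI : Integrable (fun ξ => C * (‖g ξ‖ + 2 * Real.pi / η * (|ξ| * ‖g ξ‖))) :=
    (hg.norm.add (hg1.const_mul _)).const_mul _
  refine (norm_integral_le_of_norm_le hI (Eventually.of_forall h7)).trans ?_
  rw [integral_const_mul, integral_add hg.norm (hg1.const_mul _), integral_const_mul]
  rw [le_div_iff₀ hη]
  have : C * (A + 2 * Real.pi / η * B) * η = C * (A * η + 2 * Real.pi * B) := by field_simp
  rw [this]
  nlinarith [mul_le_mul_of_nonneg_left hη1 hA, mul_nonneg hC.le hA]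


lemma psi_diff (x y : ℝ) (h : x ≤ y) : Chebyshev.psi y - Chebyshev.psi x =
    ∑ n ∈ Finset.Ioc ⌊x⌋₊ ⌊y⌋₊, ArithmeticFunction.vonMangoldt n := by
  unfold Chebyshev.psi
  have hf : ⌊x⌋₊ ≤ ⌊y⌋₊ := Nat.floor_mono h
  rw [← Finset.Ioc_union_Ioc_eq_Ioc (Nat.zero_le _) hf, Finset.sum_union]
  · ring
  · rw [Finset.disjoint_left]
    intro a ha hb
    simp only [Finset.mem_Ioc] at ha hb
    omega

lemma psi_short (k : ℕ) : ∃ c C' : ℝ, 0 < c ∧ 0 < C' ∧ ∀ L η : ℝ, 1 ≤ L → 0 < η → η ≤ 1 →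
    2 ≤ Real.exp L * η → C' ≤ L ^ k * η ^ 2 →
    c * (Real.exp L * η) ≤ Chebyshev.psi (Real.exp (L + η)) - Chebyshev.psi (Real.exp (L - η)) := by
  obtain ⟨φ, h0, h1, h2, h3, C, hC, hb⟩ := smooth_bound k
  refine ⟨(1/4)^k * Real.exp (-3) / 4, 4 * C * Real.exp 2 * 2 ^ k, by positivity, by positivity, ?_⟩
  intro L η hL hη hη1 he hC'
  set σ : ℝ := 1 + 1 / L with hσ
  have hL0 : 0 < L := by linarith
  have hσ1 : 1 < σ := by rw [hσ]; have : 0 < 1 / L := by positivity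
                         linarith
  have hσ2 : σ ≤ 2 := by
    have : 1 / L ≤ 1 := by rw [div_le_one hL0]; exact hL
    rw [hσ]; linarith
  have hT := hb σ η L hσ1 hσ2 hη hη1
  set S := Finset.Ioc ⌊Real.exp (L - η)⌋₊ ⌊Real.exp (L + η)⌋₊ with hS
  set S' := Finset.Ioc ⌊Real.exp (L - η/2)⌋₊ ⌊Real.exp (L + η/2)⌋₊ with hS'
  have memS : ∀ (η : ℝ) (n : ℕ), n ∈ Finset.Ioc ⌊Real.exp (L - η)⌋₊ ⌊Real.exp (L + η)⌋₊ ↔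
      0 < n ∧ L - η < Real.log n ∧ Real.log n ≤ L + η := by
    intro η n
    rw [Finset.mem_Ioc, Nat.floor_lt (Real.exp_pos _).le, Nat.le_floor_iff (Real.exp_pos _).le]
    constructor
    · rintro ⟨ha, hb⟩
      have hn : (0 : ℝ) < n := (Real.exp_pos _).trans ha
      exact ⟨by exact_mod_cast hn, (Real.lt_log_iff_exp_lt hn).mpr ha, (Real.log_le_iff_le_exp hn).mpr hb⟩
    · rintro ⟨hn, ha, hb⟩
      have hn : (0 : ℝ) < n := by exact_mod_cast hn
      exact ⟨(Real.lt_log_iff_exp_lt hn).mp ha, (Real.log_le_iff_le_exp hn).mp hb⟩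
  set W : ℕ → ℝ := fun n => Real.log n ^ k / (n : ℝ) ^ σ * φ ((Real.log n - L) / η) with hW
  have hW0 : ∀ n, 0 ≤ W n := fun n => by
    have := h0 ((Real.log n - L) / η)
    have := Real.log_natCast_nonneg n
    simp only [hW]; positivity
  have hsum : ∑' n, LSeries.term (bSeq k) σ n * (φ ((Real.log n - L) / η) : ℂ) =
      ((∑ n ∈ S, W n * (ArithmeticFunction.vonMangoldt n - 1) : ℝ) : ℂ) := by
    rw [tsum_eq_sum (s := S)]
    · push_cast
      refine Finset.sum_congr rfl fun n hn => ?_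
      have hn0 : n ≠ 0 := ((memS η n).mp hn).1.ne'
      rw [LSeries.term_of_ne_zero hn0, bSeq_apply, aSeq]
      simp only [hW]
      push_cast
      rw [Complex.ofReal_cpow (Nat.cast_nonneg n)]
      push_cast
      ring
    · intro n hn
      rcases eq_or_ne n 0 with rfl | hn0
      · simp
      have : φ ((Real.log n - L) / η) = 0 := by
        apply h3
        rw [abs_div, abs_of_pos hη, le_div_iff₀ hη, one_mul]
        by_contra hcon
        push Not at hcon
        rw [abs_lt] at hcon
        exact hn ((memS η n).mpr ⟨Nat.pos_of_ne_zero hn0, by linarith, by linarith⟩)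
      simp [this]
  rw [hsum, Complex.norm_real, Real.norm_eq_abs, abs_le] at hT
  have hT1 := hT.1
  simp_rw [mul_sub, mul_one, Finset.sum_sub_distrib] at hT1
  have hup : ∑ n ∈ S, W n * ArithmeticFunction.vonMangoldt n ≤
      (2 * L) ^ k * Real.exp (1 - L) * (Chebyshev.psi (Real.exp (L + η)) - Chebyshev.psi (Real.exp (L - η))) := by
    rw [psi_diff _ _ (Real.exp_le_exp.mpr (by linarith)), Finset.mul_sum]
    refine Finset.sum_le_sum fun n hn => ?_
    obtain ⟨hn0, hn1, hn2⟩ := (memS η n).mp hn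
    refine mul_le_mul_of_nonneg_right ?_ ArithmeticFunction.vonMangoldt_nonneg
    have hnp : (0 : ℝ) < n := by exact_mod_cast hn0
    have hl0 := Real.log_natCast_nonneg n
    have e1 : Real.log n ^ k ≤ (2 * L) ^ k := pow_le_pow_left₀ hl0 (by linarith) k
    have e2 : ((n : ℝ) ^ σ)⁻¹ ≤ Real.exp (1 - L) := by
      rw [← Real.rpow_neg hnp.le, Real.rpow_def_of_pos hnp]
      apply Real.exp_le_exp.mpr
      nlinarith
    simp only [hW]
    rw [div_eq_mul_inv]
    calc _ ≤ Real.log n ^ k * ((n : ℝ) ^ σ)⁻¹ * 1 := mul_le_mul_of_nonneg_left (h1 _) (by positivity)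
      _ ≤ _ := by rw [mul_one]; gcongr
  have hlow : (L / 2) ^ k * Real.exp (-L - 2) * (Real.exp L * η / 2) ≤ ∑ n ∈ S, W n := by
    have hsub : S' ⊆ S := by
      intro n hn
      obtain ⟨hn0, hn1, hn2⟩ := (memS (η/2) n).mp hn
      exact (memS η n).mpr ⟨hn0, by linarith, by linarith⟩
    have hcard : Real.exp L * η / 2 ≤ (S'.card : ℝ) := by
      rw [hS', Nat.card_Ioc]
      have f1 := Nat.floor_le (Real.exp_pos (L - η/2)).le
      have f2 := Nat.lt_floor_add_one (Real.exp (L + η/2))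
      have f3 : ⌊Real.exp (L - η/2)⌋₊ ≤ ⌊Real.exp (L + η/2)⌋₊ :=
        Nat.floor_mono (Real.exp_le_exp.mpr (by linarith))
      rw [Nat.cast_sub f3]
      have f4 : Real.exp L * η ≤ Real.exp (L + η/2) - Real.exp (L - η/2) := by
        rw [show L - η/2 = L + (-(η/2)) by ring, Real.exp_add, Real.exp_add, ← mul_sub]
        apply mul_le_mul_of_nonneg_left _ (Real.exp_pos _).le
        have := Real.self_le_sinh_iff.mpr (show 0 ≤ η / 2 by linarith)
        rw [Real.sinh_eq] at this
        linarith
      linarith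
    calc _ ≤ (L / 2) ^ k * Real.exp (-L - 2) * S'.card :=
          mul_le_mul_of_nonneg_left hcard (by positivity)
      _ = ∑ n ∈ S', (L / 2) ^ k * Real.exp (-L - 2) := by rw [Finset.sum_const, nsmul_eq_mul]; ring
      _ ≤ ∑ n ∈ S', W n := by
        refine Finset.sum_le_sum fun n hn => ?_
        obtain ⟨hn0, hn1, hn2⟩ := (memS (η/2) n).mp hn
        have hnp : (0 : ℝ) < n := by exact_mod_cast hn0
        have hφ : φ ((Real.log n - L) / η) = 1 := by
          apply h2
          rw [abs_div, abs_of_pos hη, div_le_iff₀ hη, abs_le]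
          constructor <;> linarith
        simp only [hW, hφ, mul_one, div_eq_mul_inv (Real.log n ^ k)]
        have e1 : (L / 2) ^ k ≤ Real.log n ^ k := pow_le_pow_left₀ (by positivity) (by linarith) k
        have e2 : Real.exp (-L - 2) ≤ ((n : ℝ) ^ σ)⁻¹ := by
          rw [← Real.rpow_neg hnp.le, Real.rpow_def_of_pos hnp]
          apply Real.exp_le_exp.mpr
          have : σ * Real.log n ≤ σ * (L + 1/2) := by gcongr; linarith
          have e3 : σ * (L + 1/2) = L + 1 + σ / 2 := by rw [hσ]; field_simp
          linarith
        have := Real.exp_pos (-L-2)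
        gcongr
      _ ≤ ∑ n ∈ S, W n := Finset.sum_le_sum_of_subset_of_nonneg hsub fun n _ _ => hW0 n
  set D := Chebyshev.psi (Real.exp (L + η)) - Chebyshev.psi (Real.exp (L - η)) with hD
  have hC2 : C / η ≤ (L / 2) ^ k * Real.exp (-2) * η / 4 := by
    rw [div_le_iff₀ hη, div_pow]
    have : Real.exp (-2) * Real.exp 2 = 1 := by rw [← Real.exp_add]; simp
    have h2k : (0:ℝ) < 2 ^ k := by positivity
    calc C = (4 * C * Real.exp 2 * 2 ^ k) * (Real.exp (-2) / 2 ^ k / 4) := by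
          field_simp; linear_combination -this
      _ ≤ (L ^ k * η ^ 2) * (Real.exp (-2) / 2 ^ k / 4) := by gcongr
      _ = _ := by ring
  have hex : Real.exp (-L - 2) * Real.exp L = Real.exp (-2) := by rw [← Real.exp_add]; ring_nf
  have hlow' : (L / 2) ^ k * Real.exp (-2) * η / 2 ≤ ∑ n ∈ S, W n := by
    rw [← hex]; linarith
  have hfin : (L / 2) ^ k * Real.exp (-2) * η / 4 ≤ (2 * L) ^ k * Real.exp (1 - L) * D := by linarith
  have hK : 0 < (2 * L) ^ k * Real.exp (1 - L) := by positivity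
  have hEq : (L / 2) ^ k * Real.exp (-2) * η / 4 = (2 * L) ^ k * Real.exp (1 - L) *
     ((1/4)^k * Real.exp (-3) / 4 * (Real.exp L * η)) := by
    have e1 : (L / 2) ^ k = (2 * L) ^ k * (1/4)^k := by rw [← mul_pow]; congr 1; ring
    have e2 : Real.exp (-2) = Real.exp (1 - L) * Real.exp (-3) * Real.exp L := by
      rw [← Real.exp_add, ← Real.exp_add]; ring_nf
    rw [e1, e2]; ring
  rw [hEq] at hfin
  exact le_of_mul_le_mul_left hfin hK


lemma theta_short (A : ℕ) : ∃ c X : ℝ, 0 < c ∧ 3 ≤ X ∧ ∀ y h : ℝ, X ≤ y → y / Real.log y ^ A ≤ h →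
    h ≤ y → c * h ≤ Chebyshev.theta (y + h) - Chebyshev.theta y := by
  obtain ⟨c, C', hc, hC', H⟩ := psi_short (2 * A + 1)
  have ev1 : ∀ᶠ y : ℝ in atTop, Real.log y ^ (A + 1) ≤ (c / 128) * √y := by
    have := (isLittleO_log_rpow_rpow_atTop ((A + 1 : ℕ) : ℝ) (show (0:ℝ) < 1/2 by norm_num)).bound
      (show 0 < c / 128 by positivity)
    filter_upwards [this, eventually_ge_atTop 1] with y hy h1
    rw [Real.rpow_natCast, ← Real.sqrt_eq_rpow, Real.norm_of_nonneg (Real.sqrt_nonneg _),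
      Real.norm_of_nonneg (pow_nonneg (Real.log_nonneg h1) _)] at hy
    exact hy
  have ev2 : ∀ᶠ y : ℝ in atTop, Real.log y ^ A ≤ (1 / 16) * y := by
    have := (Real.isLittleO_pow_log_id_atTop (n := A)).bound (show (0:ℝ) < 1 / 16 by positivity)
    filter_upwards [this, eventually_ge_atTop 1] with y hy h1
    rw [id, Real.norm_of_nonneg (pow_nonneg (Real.log_nonneg h1) _), Real.norm_of_nonneg (by linarith)] at hy
    exact hy
  have ev3 : ∀ᶠ y : ℝ in atTop, 64 * C' ≤ Real.log y :=
    Real.tendsto_log_atTop.eventually_ge_atTop _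
  have ev4 : ∀ᶠ y : ℝ in atTop, 1 ≤ Real.log y :=
    Real.tendsto_log_atTop.eventually_ge_atTop _
  obtain ⟨X, hX⟩ := eventually_atTop.mp (((ev1.and ev2).and (ev3.and ev4)).and (eventually_ge_atTop 3))
  refine ⟨c / 16, max X 3, by positivity, le_max_right _ _, fun y h hy h1 h2 => ?_⟩
  obtain ⟨⟨⟨a1, a2⟩, a3, a4⟩, a5⟩ := hX y ((le_max_left _ _).trans hy)
  have hy0 : 0 < y := by linarith
  have hlp : 0 < Real.log y ^ A := by positivity
  have hh : y ≤ h * Real.log y ^ A := by rwa [div_le_iff₀ hlp] at h1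
  have hh0 : 0 < h := lt_of_lt_of_le (by positivity) h1
  have hexp : Real.exp (Real.log (y + h/2)) = y + h / 2 := Real.exp_log (by positivity)
  have hηle : h / (8 * y) ≤ 1 / 8 := by rw [div_le_iff₀ (by positivity)]; linarith
  have hη0 : 0 < h / (8 * y) := by positivity
  have hlog : Real.log y ≤ Real.log (y + h/2) := Real.log_le_log hy0 (by linarith)
  have hh16 : 16 ≤ h := by
    by_contra hcon
    push Not at hcon
    have := mul_lt_mul_of_pos_right hcon hlp
    linarith
  have hprod : h ≤ 8 * ((y + h/2) * (h / (8 * y))) := by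
    have : 8 * ((y + h/2) * (h / (8 * y))) = h + h * h / (2 * y) := by field_simp
    rw [this]
    have : 0 ≤ h * h / (2 * y) := by positivity
    linarith
  have key := H (Real.log (y + h/2)) (h / (8 * y)) (by linarith) hη0 (by linarith)
    (by rw [hexp]; linarith) (by
      have e1 : 1 / (8 * Real.log y ^ A) ≤ h / (8 * y) := by
        rw [div_le_div_iff₀ (by positivity) (by positivity)]; linarith
      calc C' ≤ Real.log y / 64 := by linarith
        _ = Real.log y ^ (2 * A + 1) * (1 / (8 * Real.log y ^ A)) ^ 2 := by
          have : Real.log y ≠ 0 := by linarith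
          field_simp; ring
        _ ≤ _ := by
          have : 0 ≤ Real.log (y + h / 2) := by linarith
          gcongr)
  have hA : Real.exp (Real.log (y + h/2) + h / (8 * y)) ≤ y + h := by
    rw [Real.exp_add, hexp]
    have e1 := Real.exp_bound_div_one_sub_of_interval hη0.le (by linarith)
    have e2 : 1 / (1 - h / (8 * y)) ≤ 1 + 2 * (h / (8 * y)) := by
      rw [div_le_iff₀ (by linarith)]; nlinarith
    calc (y + h/2) * Real.exp (h / (8 * y)) ≤ (y + h/2) * (1 + 2 * (h / (8 * y))) := by gcongr; linarith
      _ = y + h / 2 + h / 4 + h * (h / (8 * y)) := by field_simp; ring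
      _ ≤ y + h := by nlinarith
  have hB : y ≤ Real.exp (Real.log (y + h/2) - h / (8 * y)) := by
    rw [sub_eq_add_neg, Real.exp_add, hexp]
    have e1 := Real.add_one_le_exp (-(h / (8 * y)))
    calc y ≤ y + h / 2 - h / 8 - (h / 2) * (h / (8 * y)) := by nlinarith
      _ = (y + h/2) * (-(h / (8 * y)) + 1) := by field_simp; ring
      _ ≤ _ := by gcongr
  have m1 := Chebyshev.psi_mono hA
  have m2 := Chebyshev.psi_mono hB
  have m3 := Chebyshev.theta_le_psi y
  have m4 := Chebyshev.psi_sub_theta_le (x := y + h) (by linarith)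
  have m5 : 2 * √(y + h) * Real.log (y + h) ≤ c / 16 * h := by
    have s1 : √(y + h) ≤ 2 * √y := by
      rw [show (2:ℝ) * √y = √(4 * y) by
        rw [Real.sqrt_mul (by norm_num), show (4:ℝ) = 2 ^ 2 by norm_num, Real.sqrt_sq (by norm_num)]]
      exact Real.sqrt_le_sqrt (by linarith)
    have s2 : Real.log (y + h) ≤ 2 * Real.log y := by
      rw [show 2 * Real.log y = Real.log (y ^ 2) by rw [Real.log_pow]; norm_num]
      exact Real.log_le_log (by linarith) (by nlinarith)
    have s3 : √y * √y = y := Real.mul_self_sqrt hy0.le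
    have s4 : 0 ≤ Real.log (y + h) := Real.log_nonneg (by linarith)
    calc 2 * √(y + h) * Real.log (y + h) ≤ 2 * (2 * √y) * (2 * Real.log y) := by gcongr
      _ ≤ c / 16 * (y / Real.log y ^ A) := by
        rw [← mul_div_assoc, le_div_iff₀ hlp]
        have := mul_le_mul_of_nonneg_left a1 (Real.sqrt_nonneg y)
        rw [pow_succ] at this
        nlinarith
      _ ≤ _ := by gcongr
  rw [hexp] at key
  have key2 : c * h ≤ 8 * (c * ((y + h/2) * (h / (8 * y)))) := by
    have := mul_le_mul_of_nonneg_left hprod hc.le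
    linarith
  linarith


open Polynomial in
lemma markov2_aux (N : ℕ) (R : ℝ[X]) (hR : R.natDegree ≤ N) (B : ℝ) (hB : 0 < B)
    (h : ∀ x ∈ Icc (-1 : ℝ) 1, |R.eval x| ≤ B) (t : ℝ) (ht : t ∈ Icc (-1 : ℝ) 1) :
    (derivative (derivative R)).eval t ≤ 4 * (N : ℝ) ^ 4 * B := by
  obtain ⟨a, b, hab, ha, hmap⟩ : ∃ a b : ℝ, a + b = t ∧ 1 / 4 ≤ a ^ 2 ∧
      ∀ u ∈ Icc (-1 : ℝ) 1, a * u + b ∈ Icc (-1 : ℝ) 1 := by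
    obtain ⟨ht1, ht2⟩ := ht
    rcases le_total 0 t with h0 | h0
    · refine ⟨(1 + t) / 2, (t - 1) / 2, by ring, by nlinarith, fun u hu => ?_⟩
      obtain ⟨hu1, hu2⟩ := hu
      constructor <;> nlinarith
    · refine ⟨-(1 - t) / 2, (t + 1) / 2, by ring, by nlinarith, fun u hu => ?_⟩
      obtain ⟨hu1, hu2⟩ := hu
      constructor <;> nlinarith
  let Q : ℝ[X] := C B⁻¹ * R.comp (C a * X + C b)
  have hQd : Q.degree ≤ N := by
    have h1 : (C a * X + C b).natDegree ≤ 1 := natDegree_linear_le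
    have h2 : Q.natDegree ≤ N := by
      refine (natDegree_C_mul_le _ _).trans ?_
      rw [natDegree_comp]
      nlinarith
    exact degree_le_of_natDegree_le h2
  have hQb : ∀ x ∈ Icc (-1 : ℝ) 1, |Q.eval x| ≤ 1 := by
    intro x hx
    have := h _ (hmap x hx)
    simp only [Q, eval_mul, eval_C, eval_comp, eval_add, eval_X, abs_mul, abs_inv, abs_of_pos hB]
    rw [inv_mul_le_iff₀ hB]
    linarith
  have key := Polynomial.Chebyshev.eval_iterate_derivative_le_of_forall_abs_le_one (k := 2)
    (le_refl (1:ℝ)) hQd hQb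
  have hT := Polynomial.Chebyshev.iterate_derivative_T_eval_one (R := ℝ) N 2
  have hQ2 : (derivative^[2] Q).eval 1 = B⁻¹ * a ^ 2 * (derivative (derivative R)).eval t := by
    simp only [Q, Function.iterate_succ, Function.iterate_zero, Function.comp, id,
      derivative_comp, derivative_mul, derivative_add, derivative_C, derivative_X]
    simp [eval_comp, hab]
    ring
  rw [hQ2] at key
  simp [Finset.prod_range_succ] at hT
  set D := (derivative (derivative R)).eval t
  rcases le_total D 0 with hD | hD
  · exact hD.trans (by positivity)
  have h3 : B⁻¹ * a ^ 2 * D ≤ (N : ℝ) ^ 4 := by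
    refine key.trans ?_
    have : 3 * eval 1 (derivative^[2] (Chebyshev.T ℝ N)) = (N:ℝ) ^ 2 * ((N : ℝ) ^ 2 - 1) := by
      simpa using hT
    nlinarith [sq_nonneg ((N:ℝ)^2), sq_nonneg (N : ℝ)]
  rw [mul_assoc, inv_mul_le_iff₀ hB] at h3
  nlinarith

open Polynomial in
lemma markov2 (N : ℕ) (R : ℝ[X]) (hR : R.natDegree ≤ N) (B : ℝ) (hB : 0 ≤ B)
    (h : ∀ x ∈ Icc (-1 : ℝ) 1, |R.eval x| ≤ B) (t : ℝ) (ht : t ∈ Icc (-1 : ℝ) 1) :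
    |(derivative (derivative R)).eval t| ≤ 4 * (N : ℝ) ^ 4 * B := by
  rcases hB.eq_or_lt with rfl | hB
  · have : R = 0 := by
      refine eq_zero_of_infinite_isRoot R ((Icc_infinite (show (-1:ℝ) < 1 by norm_num)).mono ?_)
      intro x hx
      exact abs_nonpos_iff.mp (h x hx)
    simp [this]
  rw [abs_le]
  constructor
  · have := markov2_aux N (-R) (by simpa using hR) B hB (by simpa using h) t ht
    simp at this
    linarith
  · exact markov2_aux N R hR B hB h t ht

open Polynomial in
lemma real_lip (N : ℕ) (c : ℕ → ℝ) (M : ℝ)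
    (hM : ∫ t in (-1 : ℝ)..1, |∑ k ∈ Finset.range N, c k * t ^ k| ≤ M) (t t' : ℝ)
    (ht : t ∈ Icc (-1 : ℝ) 1) (ht' : t' ∈ Icc (-1 : ℝ) 1) :
    |(∑ k ∈ Finset.range N, c k * t ^ k) - ∑ k ∈ Finset.range N, c k * t' ^ k|
      ≤ 4 * (N : ℝ) ^ 4 * M * |t - t'| := by
  let P : ℝ[X] := ∑ k ∈ Finset.range N, C (c k) * X ^ k
  have hP : ∀ t, P.eval t = ∑ k ∈ Finset.range N, c k * t ^ k := by
    intro t; simp [P, eval_finsetSum]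
  let R : ℝ[X] := ∑ k ∈ Finset.range N, C (c k / (k + 1)) * X ^ (k + 1)
  have hRd : derivative R = P := by
    simp only [R, P, derivative_sum]
    refine Finset.sum_congr rfl fun k _ => ?_
    rw [derivative_C_mul_X_pow]
    have : ((k : ℝ) + 1) ≠ 0 := by positivity
    congr 2
    push_cast
    field_simp
  have hRn : (R - C (R.eval (-1))).natDegree ≤ N := by
    rw [natDegree_sub_C]
    refine natDegree_sum_le_of_forall_le _ _ fun k hk => ?_
    refine (natDegree_C_mul_X_pow_le _ _).trans ?_
    simpa [Nat.succ_le_iff] using hk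
  simp_rw [← hP] at hM ⊢
  have hM0 : 0 ≤ M := le_trans (intervalIntegral.integral_nonneg (by norm_num) fun _ _ => abs_nonneg _) hM
  have hbd : ∀ x ∈ Icc (-1 : ℝ) 1, |(R - C (R.eval (-1))).eval x| ≤ M := by
    intro x hx
    have h1 : ∫ u in (-1 : ℝ)..x, P.eval u = R.eval x - R.eval (-1) := by
      rw [← hRd]
      exact intervalIntegral.integral_eq_sub_of_hasDerivAt (fun u _ => R.hasDerivAt u)
        ((derivative R).continuous.intervalIntegrable _ _)
    rw [eval_sub, eval_C, ← h1]
    refine (intervalIntegral.abs_integral_le_integral_abs hx.1).trans ?_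
    refine le_trans ?_ hM
    exact intervalIntegral.integral_mono_interval le_rfl hx.1 hx.2
      (Eventually.of_forall fun _ => abs_nonneg _) (P.continuous.abs.intervalIntegrable _ _)
  have hder : ∀ x ∈ Icc (-1 : ℝ) 1, ‖deriv (fun u => P.eval u) x‖ ≤ 4 * (N : ℝ) ^ 4 * M := by
    intro x hx
    have := markov2 N _ hRn M hM0 hbd x hx
    rw [derivative_sub, derivative_C, sub_zero, hRd] at this
    rw [Polynomial.deriv, Real.norm_eq_abs]
    exact this
  have := Convex.norm_image_sub_le_of_norm_deriv_le (f := fun u => P.eval u)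
    (fun x _ => P.differentiableAt) hder (convex_Icc (-1 : ℝ) 1) ht' ht
  simpa using this

lemma cpx_lip (N : ℕ) (c : ℕ → ℂ) (t t' : ℝ)
    (ht : t ∈ Icc (-1 : ℝ) 1) (ht' : t' ∈ Icc (-1 : ℝ) 1) :
    ‖(∑ k ∈ Finset.range N, c k * (t : ℂ) ^ k) - ∑ k ∈ Finset.range N, c k * (t' : ℂ) ^ k‖
      ≤ 8 * (N : ℝ) ^ 4 * (∫ t in (-1 : ℝ)..1, ‖∑ k ∈ Finset.range N, c k * (t : ℂ) ^ k‖) *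
        |t - t'| := by
  set M := ∫ t in (-1 : ℝ)..1, ‖∑ k ∈ Finset.range N, c k * (t : ℂ) ^ k‖ with hM
  have hre : ∀ t : ℝ, (∑ k ∈ Finset.range N, c k * (t : ℂ) ^ k).re =
      ∑ k ∈ Finset.range N, (c k).re * t ^ k := by
    intro t
    rw [Complex.re_sum]
    refine Finset.sum_congr rfl fun k _ => ?_
    rw [← Complex.ofReal_pow, Complex.re_mul_ofReal]
  have him : ∀ t : ℝ, (∑ k ∈ Finset.range N, c k * (t : ℂ) ^ k).im =
      ∑ k ∈ Finset.range N, (c k).im * t ^ k := by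
    intro t
    rw [Complex.im_sum]
    refine Finset.sum_congr rfl fun k _ => ?_
    rw [← Complex.ofReal_pow, Complex.im_mul_ofReal]
  have hi : ∀ f : ℝ → ℝ, Continuous f → IntervalIntegrable f volume (-1) 1 :=
    fun f hf => hf.intervalIntegrable _ _
  have h1 := real_lip N (fun k => (c k).re) M (by
    refine intervalIntegral.integral_mono_on (by norm_num) (hi _ (by fun_prop)) (hi _ (by fun_prop)) ?_
    intro x _
    rw [← hre]; exact Complex.abs_re_le_norm _) t t' ht ht'
  have h2 := real_lip N (fun k => (c k).im) M (by
    refine intervalIntegral.integral_mono_on (by norm_num) (hi _ (by fun_prop)) (hi _ (by fun_prop)) ?_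
    intro x _
    rw [← him]; exact Complex.abs_im_le_norm _) t t' ht ht'
  rw [← hre, ← hre, ← Complex.sub_re] at h1
  rw [← him, ← him, ← Complex.sub_im] at h2
  refine (Complex.norm_le_abs_re_add_abs_im _).trans ?_
  linarith


noncomputable def xs (n : ℕ) : ℝ := (5 / 4 : ℝ) ^ n

noncomputable def blk (n : ℕ) : Finset ℕ := (Finset.Ioc ⌊xs n⌋₊ ⌊xs (n + 1)⌋₊).filter Nat.Prime

noncomputable def tt (n : ℕ) (u : ℝ) : ℝ := 8 * u / xs n - 9

lemma xs_pos (n : ℕ) : 0 < xs n := by unfold xs; positivity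

lemma xs_succ (n : ℕ) : xs (n + 1) = 5 / 4 * xs n := by unfold xs; ring

lemma psum_diff (f : ℕ → ℝ) (x y : ℝ) (h : x ≤ y) :
    (∑ p ∈ (Finset.Ioc 0 ⌊y⌋₊).filter Nat.Prime, f p) - ∑ p ∈ (Finset.Ioc 0 ⌊x⌋₊).filter Nat.Prime, f p =
    ∑ p ∈ (Finset.Ioc ⌊x⌋₊ ⌊y⌋₊).filter Nat.Prime, f p := by
  have hf : ⌊x⌋₊ ≤ ⌊y⌋₊ := Nat.floor_mono h
  rw [← Finset.Ioc_union_Ioc_eq_Ioc (Nat.zero_le _) hf, Finset.filter_union, Finset.sum_union]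
  · ring
  · rw [Finset.disjoint_left]
    intro a ha hb
    simp only [Finset.mem_filter, Finset.mem_Ioc] at ha hb
    omega

lemma theta_diff (x y : ℝ) (h : x ≤ y) : Chebyshev.theta y - Chebyshev.theta x =
    ∑ p ∈ (Finset.Ioc ⌊x⌋₊ ⌊y⌋₊).filter Nat.Prime, Real.log p := psum_diff (fun p => Real.log p) x y h

lemma prime_lower : ∃ c : ℝ, 0 < c ∧ ∃ n1 : ℕ, 1 ≤ n1 ∧ ∀ n, n1 ≤ n → ∀ a : ℕ → ℂ,
    c * xs n * (∫ t in (-1 : ℝ)..1, ‖∑ k ∈ Finset.range n, a k * (t : ℂ) ^ k‖) ≤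
      ∑ p ∈ blk n, Real.log p * ‖∑ k ∈ Finset.range n, a k * (tt n p : ℂ) ^ k‖ := by
  obtain ⟨c, X, hc, hX, H⟩ := theta_short 5
  obtain ⟨n2, hn2⟩ := (tendsto_pow_atTop_atTop_of_one_lt (show (1:ℝ) < 5/4 by norm_num)).eventually_ge_atTop X |>.exists_forall_of_atTop
  refine ⟨c / 16, by positivity, n2 + 640 * 5 ^ 5, by omega, fun n hn a => ?_⟩
  have hxX : X ≤ xs n := hn2 n (by omega)
  have hx0 := xs_pos n
  have hnN : (640 * 5 ^ 5 : ℝ) ≤ n := by exact_mod_cast (by omega : 640 * 5 ^ 5 ≤ n)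
  have hn0 : (0 : ℝ) < n := by linarith
  set P : ℝ → ℂ := fun t => ∑ k ∈ Finset.range n, a k * (t : ℂ) ^ k with hP
  have hPc : Continuous P := by fun_prop
  set M := ∫ t in (-1 : ℝ)..1, ‖P t‖ with hM
  have hM0 : 0 ≤ M := intervalIntegral.integral_nonneg (by norm_num) fun _ _ => norm_nonneg _
  set J : ℕ := 128 * n ^ 4 with hJ
  have hJr : (J : ℝ) = 128 * (n : ℝ) ^ 4 := by rw [hJ]; push_cast; ring
  have hJ0 : (0 : ℝ) < J := by rw [hJr]; positivity
  have lip : ∀ t ∈ Icc (-1 : ℝ) 1, ∀ t' ∈ Icc (-1 : ℝ) 1, |t - t'| ≤ 2 / J → ‖P t - P t'‖ ≤ M / 8 := by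
    intro t ht t' ht' h
    refine (cpx_lip n a t t' ht ht').trans ?_
    calc 8 * (n : ℝ) ^ 4 * M * |t - t'| ≤ 8 * (n : ℝ) ^ 4 * M * (2 / J) := by gcongr
      _ = M / 8 := by rw [hJr]; field_simp; ring
  set τ : ℕ → ℝ := fun j => -1 + 2 * j / J with hτ
  set y : ℕ → ℝ := fun j => xs n * (9 + τ j) / 8 with hy
  have hτs : ∀ j, τ (j + 1) = τ j + 2 / J := by intro j; simp only [hτ]; push_cast; ring
  have hτ0 : τ 0 = -1 := by simp [hτ]
  have hτJ : τ J = 1 := by simp only [hτ]; field_simp; norm_num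
  have hτmem : ∀ j ≤ J, τ j ∈ Icc (-1 : ℝ) 1 := by
    intro j hj
    have : (j : ℝ) ≤ J := by exact_mod_cast hj
    have h1 : 2 * (j : ℝ) / J ≤ 2 := by rw [div_le_iff₀ hJ0]; linarith
    have h2 : 0 ≤ 2 * (j : ℝ) / J := by positivity
    simp only [hτ]
    constructor <;> linarith
  have hys : ∀ j, y (j + 1) = y j + xs n / (4 * J) := by
    intro j; simp only [hy, hτs]; field_simp; ring
  have hy0 : y 0 = xs n := by simp only [hy, hτ0]; ring
  have hyJ : y J = xs (n + 1) := by simp only [hy, hτJ, xs_succ]; ring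
  have httmem : ∀ u j, y j < u → u ≤ y (j + 1) → τ j < tt n u ∧ tt n u ≤ τ (j + 1) := by
    intro u j h1 h2
    simp only [hy] at h1 h2
    unfold tt
    constructor
    · rw [lt_sub_iff_add_lt, lt_div_iff₀ hx0]; linarith
    · rw [sub_le_iff_le_add, div_le_iff₀ hx0]; linarith
  set f : ℕ → ℝ := fun p => Real.log p * ‖P (tt n p)‖ with hf
  have hf0 : ∀ p, 0 ≤ f p := fun p => mul_nonneg (Real.log_natCast_nonneg p) (norm_nonneg _)
  -- per-piece estimate
  have piece : ∀ j < J, (c / 8) * xs n * ((∫ t in τ j..τ (j + 1), ‖P t‖) - M / (2 * J)) ≤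
      ∑ p ∈ (Finset.Ioc ⌊y j⌋₊ ⌊y (j + 1)⌋₊).filter Nat.Prime, f p := by
    intro j hj
    have m1 := hτmem j hj.le
    have m2 := hτmem (j + 1) hj
    have hlt : τ j ≤ τ (j + 1) := by rw [hτs]; have : 0 < 2 / (J : ℝ) := by positivity
                                     linarith
    have near : ∀ t, τ j ≤ t → t ≤ τ (j + 1) → ‖P t - P (τ j)‖ ≤ M / 8 := by
      intro t h1 h2
      refine lip t ⟨m1.1.trans h1, h2.trans m2.2⟩ _ m1 ?_
      rw [abs_of_nonneg (by linarith)]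
      rw [hτs] at h2; linarith
    have hIntg : (∫ t in τ j..τ (j + 1), ‖P t‖) ≤ (2 / J) * (‖P (τ j)‖ + M / 8) := by
      calc (∫ t in τ j..τ (j + 1), ‖P t‖) ≤ ∫ t in τ j..τ (j + 1), (‖P (τ j)‖ + M / 8) := by
            refine intervalIntegral.integral_mono_on hlt (hPc.norm.intervalIntegrable _ _)
              (continuous_const.intervalIntegrable _ _) fun t ht => ?_
            have h1 := near t ht.1 ht.2
            have h2 := norm_sub_norm_le (P t) (P (τ j))
            linarith
        _ = _ := by rw [intervalIntegral.integral_const, smul_eq_mul, hτs]; ring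
    have hsum0 : 0 ≤ ∑ p ∈ (Finset.Ioc ⌊y j⌋₊ ⌊y (j + 1)⌋₊).filter Nat.Prime, f p :=
      Finset.sum_nonneg fun p _ => hf0 p
    have hcx : 0 ≤ (c / 8) * xs n := by positivity
    have hstep : (∫ t in τ j..τ (j + 1), ‖P t‖) - M / (2 * J) ≤ (2 / J) * (‖P (τ j)‖ - M / 8) := by
      have : (2 / J) * (‖P (τ j)‖ - M / 8) = (2 / J) * (‖P (τ j)‖ + M / 8) - M / (2 * J) := by
        field_simp; ring
      linarith
    refine (mul_le_mul_of_nonneg_left hstep hcx).trans ?_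
    rcases le_total (‖P (τ j)‖ - M / 8) 0 with hneg | hpos
    · refine le_trans ?_ hsum0
      refine mul_nonpos_of_nonneg_of_nonpos hcx (mul_nonpos_of_nonneg_of_nonpos (by positivity) hneg)
    · have hyge : xs n ≤ y j := by
        simp only [hy]; have := m1.1; rw [le_div_iff₀ (by norm_num)]; nlinarith
      have hyle : y j ≤ 5 / 4 * xs n := by
        simp only [hy]; have := m1.2; rw [div_le_iff₀ (by norm_num)]; nlinarith
      have hlog : (n : ℝ) / 5 ≤ Real.log (y j) := by
        calc (n : ℝ) / 5 ≤ n * Real.log (5/4) := by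
              have := Real.one_sub_inv_le_log_of_pos (show (0:ℝ) < 5/4 by norm_num)
              norm_num at this
              nlinarith
          _ = Real.log (xs n) := by unfold xs; rw [Real.log_pow]
          _ ≤ _ := Real.log_le_log hx0 hyge
      have hcond : y j / Real.log (y j) ^ 5 ≤ xs n / (4 * J) := by
        calc y j / Real.log (y j) ^ 5 ≤ (5 / 4 * xs n) / ((n : ℝ) / 5) ^ 5 := by gcongr
          _ ≤ xs n / (4 * J) := by
            rw [hJr, div_le_div_iff₀ (by positivity) (by positivity)]
            have e1 : 5 / 4 * xs n * (4 * (128 * (n : ℝ) ^ 4)) = xs n * (n : ℝ) ^ 4 / 5 ^ 5 * (640 * 5 ^ 5) := by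
              ring
            have e2 : xs n * ((n : ℝ) / 5) ^ 5 = xs n * (n : ℝ) ^ 4 / 5 ^ 5 * n := by ring
            rw [e1, e2]
            gcongr
      have hcond2 : xs n / (4 * J) ≤ y j := by
        refine le_trans ?_ hyge
        refine div_le_self hx0.le ?_
        have : (1 : ℝ) ≤ J := by
          have : 0 < J := by exact_mod_cast hJ0
          exact_mod_cast this
        linarith
      have hθ := H (y j) (xs n / (4 * J)) (hxX.trans hyge) hcond hcond2
      have hyle2 : y j ≤ y (j + 1) := by
        rw [hys]; have : 0 < xs n / (4 * J) := by positivity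
        linarith
      rw [← hys, theta_diff _ _ hyle2] at hθ
      calc c / 8 * xs n * (2 / J * (‖P (τ j)‖ - M / 8)) = (c * (xs n / (4 * J))) * (‖P (τ j)‖ - M / 8) := by
            field_simp; ring
        _ ≤ (∑ p ∈ (Finset.Ioc ⌊y j⌋₊ ⌊y (j + 1)⌋₊).filter Nat.Prime, Real.log p) * (‖P (τ j)‖ - M / 8) :=
            mul_le_mul_of_nonneg_right hθ hpos
        _ ≤ _ := by
          rw [Finset.sum_mul]
          refine Finset.sum_le_sum fun p hp => ?_
          rw [Finset.mem_filter, Finset.mem_Ioc, Nat.floor_lt (by linarith), Nat.le_floor_iff (by linarith)] at hp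
          obtain ⟨b1, b2⟩ := httmem p j hp.1.1 hp.1.2
          refine mul_le_mul_of_nonneg_left ?_ (Real.log_natCast_nonneg p)
          have h1 := near (tt n p) b1.le b2
          have h2 := norm_sub_norm_le (P (τ j)) (P (tt n p))
          rw [norm_sub_rev] at h1
          linarith
  have total := Finset.sum_le_sum fun j (hj : j ∈ Finset.range J) => piece j (Finset.mem_range.mp hj)
  have hR : ∑ j ∈ Finset.range J, ∑ p ∈ (Finset.Ioc ⌊y j⌋₊ ⌊y (j + 1)⌋₊).filter Nat.Prime, f p =
      ∑ p ∈ blk n, f p := by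
    have hyle2 : ∀ j, y j ≤ y (j + 1) := by
      intro j
      rw [hys]; have : 0 < xs n / (4 * J) := by positivity
      linarith
    have : ∀ j ∈ Finset.range J, ∑ p ∈ (Finset.Ioc ⌊y j⌋₊ ⌊y (j + 1)⌋₊).filter Nat.Prime, f p =
      (fun j => ∑ p ∈ (Finset.Ioc 0 ⌊y j⌋₊).filter Nat.Prime, f p) (j + 1) -
      (fun j => ∑ p ∈ (Finset.Ioc 0 ⌊y j⌋₊).filter Nat.Prime, f p) j := fun j _ =>
        (psum_diff f _ _ (hyle2 j)).symm
    rw [Finset.sum_congr rfl this, Finset.sum_range_sub (fun j => ∑ p ∈ (Finset.Ioc 0 ⌊y j⌋₊).filter Nat.Prime, f p)]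
    simp only [hy0, hyJ]
    rw [psum_diff f _ _ (by rw [xs_succ]; linarith)]
    rfl
  have hLs : ∑ j ∈ Finset.range J, ∫ t in τ j..τ (j + 1), ‖P t‖ = M := by
    rw [intervalIntegral.sum_integral_adjacent_intervals
      (fun j _ => hPc.norm.intervalIntegrable _ _), hτ0, hτJ]
  rw [hR, ← Finset.mul_sum, Finset.sum_sub_distrib, hLs, Finset.sum_const, Finset.card_range,
    nsmul_eq_mul] at total
  have : (J : ℝ) * (M / (2 * J)) = M / 2 := by field_simp
  rw [this] at total
  refine le_trans (le_of_eq ?_) total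
  ring


lemma dual_exists {ι : Type} [Fintype ι] (N : ℕ) (w : ι → ℝ) (v : ι → Fin N → ℂ) (z : Fin N → ℂ)
    (H : ∀ c : Fin N → ℂ, ‖∑ k, c k * z k‖ ≤ ∑ p, w p * ‖∑ k, c k * v p k‖) :
    ∃ χ : ι → ℂ, χ ∈ Metric.closedBall (0 : ι → ℂ) 1 ∧
      Fintype.linearCombination ℂ (fun p k => (w p : ℂ) * v p k) χ = z := by
  set T := Fintype.linearCombination ℂ (fun p k => (w p : ℂ) * v p k) with hT
  by_contra hcon
  have hz : z ∉ T '' Metric.closedBall (0 : ι → ℂ) 1 := by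
    rintro ⟨χ, h1, h2⟩
    exact hcon ⟨χ, h1, h2⟩
  have hTc : Continuous T := LinearMap.continuous_of_finiteDimensional T
  have hconv : Convex ℝ (T '' Metric.closedBall (0 : ι → ℂ) 1) :=
    (convex_closedBall (0 : ι → ℂ) 1).linear_image (T.restrictScalars ℝ)
  have hcl : IsClosed (T '' Metric.closedBall (0 : ι → ℂ) 1) :=
    ((isCompact_closedBall (0 : ι → ℂ) 1).image hTc).isClosed
  obtain ⟨f, u, hf1, hf2⟩ := RCLike.geometric_hahn_banach_closed_point (𝕜 := ℂ) hconv hcl hz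
  set c : Fin N → ℂ := fun k => f (fun j => if k = j then 1 else 0) with hc
  have hfx : ∀ x : Fin N → ℂ, f x = ∑ k, c k * x k := by
    intro x
    have := LinearMap.pi_apply_eq_sum_univ (f : (Fin N → ℂ) →ₗ[ℂ] ℂ) x
    simp only [ContinuousLinearMap.coe_coe, smul_eq_mul] at this
    rw [this]
    exact Finset.sum_congr rfl fun k _ => mul_comm _ _
  set g : ι → ℂ := fun p => ∑ k, c k * v p k with hg
  set χ : ι → ℂ := fun p => (starRingEnd ℂ) (g p) / ‖g p‖ with hχ
  have hχ1 : χ ∈ Metric.closedBall (0 : ι → ℂ) 1 := by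
    rw [mem_closedBall_zero_iff, pi_norm_le_iff_of_nonneg zero_le_one]
    intro p
    simp only [hχ, norm_div, RCLike.norm_conj, Complex.norm_real, norm_norm]
    exact div_self_le_one _
  have h1 := hf1 _ ⟨χ, hχ1, rfl⟩
  have h2 : f (T χ) = ((∑ p, w p * ‖g p‖ : ℝ) : ℂ) := by
    rw [hT, Fintype.linearCombination_apply, map_sum]
    push_cast
    refine Finset.sum_congr rfl fun p _ => ?_
    rw [map_smul, hfx, smul_eq_mul]
    have e1 : ∑ k, c k * ((w p : ℂ) * v p k) = w p * g p := by
      simp only [hg, Finset.mul_sum]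
      exact Finset.sum_congr rfl fun k _ => by ring
    rw [e1]
    simp only [hχ]
    by_cases h0 : g p = 0
    · simp [h0]
    · have h0' : (‖g p‖ : ℂ) ≠ 0 := by simpa using h0
      have e2 : (starRingEnd ℂ) (g p) * g p = (‖g p‖ : ℂ) ^ 2 := Complex.conj_mul' _
      field_simp
      linear_combination (w p : ℂ) * e2
  rw [h2] at h1
  have h3 := H c
  rw [← hfx] at h3
  have h4 : (f z).re ≤ ‖f z‖ := Complex.re_le_norm _
  simp only [RCLike.re_to_complex, Complex.ofReal_re] at h1 hf2
  linarith

lemma dual_round {ι : Type} [Fintype ι] (N : ℕ) (w : ι → ℝ) (v : ι → Fin N → ℂ) (z : Fin N → ℂ)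
    (H : ∀ c : Fin N → ℂ, ‖∑ k, c k * z k‖ ≤ ∑ p, w p * ‖∑ k, c k * v p k‖) :
    ∃ χ : ι → ℂ, (∀ p, ‖χ p‖ ≤ 1) ∧ (∀ k, ∑ p, χ p * (w p * v p k) = z k) ∧
      ∃ B : Finset ι, B.card ≤ N ∧ ∀ p ∉ B, ‖χ p‖ = 1 := by
  classical
  obtain ⟨χ0, h01, h02⟩ := dual_exists N w v z H
  set T := Fintype.linearCombination ℂ (fun p k => (w p : ℂ) * v p k) with hT
  have hTc : Continuous T := LinearMap.continuous_of_finiteDimensional T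
  set F : Set (ι → ℂ) := Metric.closedBall (0 : ι → ℂ) 1 ∩ T ⁻¹' {z} with hF
  have hFc : IsCompact F := (isCompact_closedBall _ _).inter_right (isClosed_singleton.preimage hTc)
  obtain ⟨χ, hχ⟩ := hFc.extremePoints_nonempty ⟨χ0, h01, h02⟩
  rw [mem_extremePoints] at hχ
  obtain ⟨⟨hχ1, hχ2⟩, hext⟩ := hχ
  have hmem : ∀ x : ι → ℂ, x ∈ Metric.closedBall (0 : ι → ℂ) 1 ↔ ∀ p, ‖x p‖ ≤ 1 := by
    intro x
    rw [mem_closedBall_zero_iff, pi_norm_le_iff_of_nonneg zero_le_one]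
  rw [hmem] at hχ1
  refine ⟨χ, hχ1, ?_, Finset.univ.filter (fun p => ‖χ p‖ < 1), ?_, ?_⟩
  · intro k
    have := congrFun hχ2 k
    rw [hT, Fintype.linearCombination_apply, Finset.sum_apply] at this
    simpa using this
  · by_contra hcard
    push Not at hcard
    let R : (ι → ℂ) →ₗ[ℂ] ({p : ι // ¬ ‖χ p‖ < 1} → ℂ) := LinearMap.funLeft ℂ ℂ Subtype.val
    have hker : (T.prod R).ker ≠ ⊥ := by
      apply LinearMap.ker_ne_bot_of_finrank_lt
      rw [Module.finrank_prod, Module.finrank_fintype_fun_eq_card, Module.finrank_fintype_fun_eq_card,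
        Module.finrank_fintype_fun_eq_card, Fintype.card_fin, Fintype.card_subtype_compl,
        Fintype.card_subtype]
      have : (Finset.univ.filter (fun p => ‖χ p‖ < 1)).card ≤ Fintype.card ι := Finset.card_le_univ _
      omega
    obtain ⟨d, hd, hd0⟩ := Submodule.exists_mem_ne_zero_of_ne_bot hker
    rw [LinearMap.mem_ker, LinearMap.prod_apply] at hd
    have hd1 : T d = 0 := congrArg Prod.fst hd
    have hd2 : ∀ p, ¬ ‖χ p‖ < 1 → d p = 0 := by
      intro p hp
      exact congrFun (congrArg Prod.snd hd : R d = 0) ⟨p, hp⟩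
    have hev : ∀ p, ∀ᶠ ε : ℝ in 𝓝[>] 0, ‖χ p + (ε : ℂ) * d p‖ ≤ 1 ∧ ‖χ p - (ε : ℂ) * d p‖ ≤ 1 := by
      intro p
      by_cases hp : ‖χ p‖ < 1
      · apply Filter.Eventually.filter_mono nhdsWithin_le_nhds
        have c1 : Continuous fun ε : ℝ => ‖χ p + (ε : ℂ) * d p‖ := by fun_prop
        have c2 : Continuous fun ε : ℝ => ‖χ p - (ε : ℂ) * d p‖ := by fun_prop
        have e1 := c1.continuousAt.eventually_lt (x₀ := 0) (g := fun _ => (1:ℝ)) continuousAt_const (by simpa using hp)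
        have e2 := c2.continuousAt.eventually_lt (x₀ := 0) (g := fun _ => (1:ℝ)) continuousAt_const (by simpa using hp)
        filter_upwards [e1, e2] with ε h1 h2
        exact ⟨h1.le, h2.le⟩
      · refine Eventually.of_forall fun ε => ?_
        rw [hd2 p hp]
        simpa using hχ1 p
    obtain ⟨ε, hε, hε0⟩ := ((eventually_all.mpr hev).and self_mem_nhdsWithin).exists
    have hε0 : 0 < ε := hε0
    have m1 : χ + (ε : ℂ) • d ∈ F := by
      refine ⟨(hmem _).mpr fun p => (hε p).1, ?_⟩
      change T _ = z
      rw [map_add, map_smul, hd1, smul_zero, add_zero]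
      exact hχ2
    have m2 : χ - (ε : ℂ) • d ∈ F := by
      refine ⟨(hmem _).mpr fun p => (hε p).2, ?_⟩
      change T _ = z
      rw [map_sub, map_smul, hd1, smul_zero, sub_zero]
      exact hχ2
    have := (hext _ m1 _ m2 ⟨1/2, 1/2, by norm_num, by norm_num, by norm_num, by
      rw [← smul_add, add_add_sub_cancel, ← two_smul ℝ χ, smul_smul]; norm_num⟩).1
    rw [add_eq_left, smul_eq_zero] at this
    rcases this with h | h
    · exact hε0.ne' (by exact_mod_cast h)
    · exact hd0 h
  · intro p hp
    simp only [Finset.mem_filter, Finset.mem_univ, true_and, not_lt] at hp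
    exact le_antisymm (hχ1 p) hp


lemma taylor_approx (R : ℝ) : ∃ C : ℝ, 0 < C ∧ ∀ s : ℂ, ‖s‖ ≤ R → ∀ n : ℕ, ∃ b : ℕ → ℂ,
    ∀ t : ℝ, t ∈ Icc (-1 : ℝ) 1 →
      ‖(1 + (t : ℂ) / 9) ^ (-s) - ∑ k ∈ Finset.range n, b k * (t : ℂ) ^ k‖ ≤ C * (1 / 4) ^ n := by
  refine ⟨2 * Real.exp R, by positivity, fun s hs n => ?_⟩
  set f : ℂ → ℂ := fun w => (1 + w / 9) ^ (-s) with hf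
  have hre : ∀ w : ℂ, ‖w‖ < 5 → (1 + w / 9) ∈ slitPlane := by
    intro w hw
    left
    have h1 : |w.re| ≤ ‖w‖ := Complex.abs_re_le_norm w
    have h2 := (abs_le.mp h1).1
    have : (1 + w / 9).re = 1 + w.re / 9 := by
      simp
    rw [this]
    linarith
  have hd : DifferentiableOn ℂ f (Metric.ball 0 5) := by
    intro w hw
    have := hre w (by simpa using hw)
    refine DifferentiableAt.differentiableWithinAt ?_
    exact (((differentiableAt_const _).add (differentiableAt_id.div_const _))).cpow
      (differentiableAt_const _) this
  have hb : ∀ w ∈ Metric.sphere (0 : ℂ) 4, ‖f w‖ ≤ Real.exp R := by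
    intro w hw
    have hw4 : ‖w‖ = 4 := by simpa using hw
    have h0 := slitPlane_ne_zero (hre w (by rw [hw4]; norm_num))
    simp only [hf]
    rw [cpow_def_of_ne_zero h0]
    refine (Complex.norm_exp_le_exp_norm _).trans (Real.exp_le_exp.mpr ?_)
    have h9 : ‖w / 9‖ = 4 / 9 := by rw [norm_div, hw4]; norm_num
    have := Complex.norm_log_one_add_half_le_self (z := w / 9) (by rw [h9]; norm_num)
    rw [h9] at this
    rw [norm_mul, norm_neg]
    nlinarith [norm_nonneg s]
  have hcoef : ∀ k, ‖(k.factorial : ℂ)⁻¹ * iteratedDeriv k f 0‖ ≤ Real.exp R * (1 / 4) ^ k := by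
    intro k
    have hdc : DiffContOnCl ℂ f (Metric.ball 0 4) :=
      hd.diffContOnCl_ball (Metric.closedBall_subset_ball (by norm_num))
    have := Complex.norm_iteratedDeriv_le_of_forall_mem_sphere_norm_le k (by norm_num : (0:ℝ) < 4) hdc hb
    rw [norm_mul, norm_inv, Complex.norm_natCast]
    have hk : (0 : ℝ) < k.factorial := by positivity
    rw [inv_mul_le_iff₀ hk]
    refine this.trans (le_of_eq ?_)
    rw [one_div, inv_pow]; field_simp
  refine ⟨fun k => (k.factorial : ℂ)⁻¹ * iteratedDeriv k f 0, fun t ht => ?_⟩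
  have htn : ‖(t : ℂ)‖ ≤ 1 := by rw [Complex.norm_real]; exact abs_le.mpr ht
  have hsum := Complex.hasSum_taylorSeries_on_ball hd (z := (t : ℂ)) (by
    simp only [Metric.mem_ball, dist_zero_right]; linarith)
  have hterm : ∀ k, ‖(k.factorial : ℂ)⁻¹ * iteratedDeriv k f 0 * (t : ℂ) ^ k‖ ≤ Real.exp R * (1 / 4) ^ k := by
    intro k
    rw [norm_mul, norm_pow]
    calc _ ≤ Real.exp R * (1 / 4) ^ k * 1 := by
          gcongr
          · exact hcoef k
          · exact pow_le_one₀ (norm_nonneg _) htn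
      _ = _ := mul_one _
  have hsum' : HasSum (fun k => (k.factorial : ℂ)⁻¹ * iteratedDeriv k f 0 * (t : ℂ) ^ k) (f t) := by
    have e : (fun k : ℕ => (k.factorial : ℂ)⁻¹ * iteratedDeriv k f 0 * (t : ℂ) ^ k) =
        fun k : ℕ => (k.factorial : ℂ)⁻¹ • ((t : ℂ) - 0) ^ k • iteratedDeriv k f 0 := by
      funext k
      simp only [sub_zero, smul_eq_mul]
      ring
    rw [e]
    exact hsum
  have htail := (hasSum_nat_add_iff' n).mpr hsum'
  have hg : HasSum (fun k => Real.exp R * (1 / 4 : ℝ) ^ n * (1 / 4) ^ k)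
      (Real.exp R * (1 / 4 : ℝ) ^ n * (1 - 1 / 4)⁻¹) :=
    (hasSum_geometric_of_lt_one (by norm_num) (by norm_num)).mul_left _
  have := htail.norm_le_of_bounded hg (fun k => by
    refine (hterm (k + n)).trans (le_of_eq ?_)
    rw [pow_add]; ring)
  refine this.trans ?_
  have : 0 < Real.exp R * (1/4 : ℝ) ^ n := by positivity
  have e : (1 - 1 / 4 : ℝ)⁻¹ = 4 / 3 := by norm_num
  rw [e]
  nlinarith


lemma xs_one_le (n : ℕ) : 1 ≤ xs n := one_le_pow₀ (by norm_num)

lemma xs_lt (n : ℕ) : xs n < xs (n + 1) := by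
  rw [xs_succ]; linarith [xs_pos n]

lemma mem_blk (n p : ℕ) : p ∈ blk n ↔ p.Prime ∧ xs n < p ∧ (p : ℝ) ≤ xs (n + 1) := by
  unfold blk
  rw [Finset.mem_filter, Finset.mem_Ioc, Nat.floor_lt (xs_pos n).le, Nat.le_floor_iff (xs_pos _).le]
  tauto

lemma tt_mem (n : ℕ) (u : ℝ) (h1 : xs n ≤ u) (h2 : u ≤ xs (n + 1)) : tt n u ∈ Icc (-1 : ℝ) 1 := by
  have := xs_pos n
  rw [xs_succ] at h2
  unfold tt
  constructor
  · rw [le_sub_iff_add_le, le_div_iff₀ this]; linarith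
  · rw [sub_le_iff_le_add, div_le_iff₀ this]; linarith

lemma q_int {q : ℝ → ℂ} (hqloc : LocallyIntegrableOn q (Ici 1)) {a b : ℝ} (ha : 1 ≤ a)
    {g : ℝ → ℂ} (hg : ContinuousOn g (Icc a b)) : IntegrableOn (fun u => q u * g u) (Ioc a b) := by
  have h1 : IntegrableOn q (Icc a b) :=
    hqloc.integrableOn_compact_subset (fun x hx => ha.trans hx.1) isCompact_Icc
  exact (h1.mul_continuousOn hg isCompact_Icc).mono_set Ioc_subset_Icc_self

lemma block_choice {q : ℝ → ℂ} (hq0 : Tendsto q atTop (𝓝 0)) (hqloc : LocallyIntegrableOn q (Ici 1)) :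
    ∃ n0 : ℕ, ∀ n, n0 ≤ n → (∀ u, xs n ≤ u → ‖q u‖ ≤ 1) ∧ ∃ χ : ℕ → ℂ, ∃ B : Finset ℕ,
      B ⊆ blk n ∧ B.card ≤ n ∧ (∀ p ∈ blk n, ‖χ p‖ ≤ 1) ∧ (∀ p ∈ blk n, p ∉ B → ‖χ p‖ = 1) ∧
      ∀ k < n, (∫ u in Ioc (xs n) (xs (n + 1)), q u * (tt n u : ℂ) ^ k) +
        ∑ p ∈ blk n, χ p * ((Real.log p : ℂ) * (tt n p : ℂ) ^ k) = 0 := by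
  obtain ⟨c, hc, n1, hn1, H⟩ := prime_lower
  have hε : 0 < min 1 (8 * c) := by positivity
  have hev : ∀ᶠ u in atTop, ‖q u‖ ≤ min 1 (8 * c) := by
    have := hq0.norm
    rw [norm_zero] at this
    exact (this.eventually_lt_const hε).mono fun u hu => hu.le
  obtain ⟨U, hU⟩ := eventually_atTop.mp hev
  obtain ⟨n2, hn2⟩ := (tendsto_pow_atTop_atTop_of_one_lt (show (1:ℝ) < 5/4 by norm_num)).eventually_ge_atTop U |>.exists_forall_of_atTop
  refine ⟨max n1 n2, fun n hn => ?_⟩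
  have hn1' : n1 ≤ n := (le_max_left _ _).trans hn
  have hqb : ∀ u, xs n ≤ u → ‖q u‖ ≤ min 1 (8 * c) := fun u hu =>
    hU u ((hn2 n ((le_max_right _ _).trans hn)).trans hu)
  refine ⟨fun u hu => (hqb u hu).trans (min_le_left _ _), ?_⟩
  have hx := xs_pos n
  have httc : Continuous (tt n) := by unfold tt; fun_prop
  set z : Fin n → ℂ := fun k => -∫ u in Ioc (xs n) (xs (n + 1)), q u * (tt n u : ℂ) ^ (k : ℕ) with hz
  obtain ⟨χ, hχ1, hχ2, B, hB1, hB2⟩ := dual_round (ι := {p // p ∈ blk n}) n (fun p => Real.log p)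
    (fun p k => (tt n p : ℂ) ^ (k : ℕ)) z (by
      intro a'
      set a : ℕ → ℂ := fun k => if h : k < n then a' ⟨k, h⟩ else 0 with ha
      have hconv : ∀ t : ℂ, ∑ k : Fin n, a' k * t ^ (k : ℕ) = ∑ k ∈ Finset.range n, a k * t ^ k := by
        intro t
        rw [Finset.sum_range]
        refine Finset.sum_congr rfl fun k _ => ?_
        simp [ha]
      have hlow := H n hn1' a
      simp only [hconv]
      rw [← Finset.sum_coe_sort (blk n)] at hlow
      refine le_trans ?_ hlow
      have e1 : ∑ k, a' k * z k = -∫ u in Ioc (xs n) (xs (n + 1)),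
          q u * ∑ k ∈ Finset.range n, a k * (tt n u : ℂ) ^ k := by
        simp only [hz, mul_neg, Finset.sum_neg_distrib]
        congr 1
        simp_rw [← hconv, Finset.mul_sum]
        rw [integral_finsetSum]
        · refine Finset.sum_congr rfl fun k _ => ?_
          rw [← integral_const_mul]
          congr 1
          funext u
          ring
        · intro k _
          exact q_int hqloc (xs_one_le n) (g := fun u => a' k * (tt n u : ℂ) ^ (k : ℕ)) (by fun_prop)
      rw [e1, norm_neg]
      set P : ℝ → ℂ := fun t => ∑ k ∈ Finset.range n, a k * (t : ℂ) ^ k with hP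
      have hPc : Continuous P := by fun_prop
      have hPi : IntegrableOn (fun u => 8 * c * ‖P (tt n u)‖) (Ioc (xs n) (xs (n + 1))) :=
        (Continuous.integrableOn_Icc (by fun_prop)).mono_set Ioc_subset_Icc_self
      refine (norm_integral_le_of_norm_le hPi ?_).trans ?_
      · refine (ae_restrict_iff' measurableSet_Ioc).mpr (Eventually.of_forall fun u hu => ?_)
        rw [norm_mul]
        exact mul_le_mul_of_nonneg_right ((hqb u hu.1.le).trans (min_le_right _ _)) (norm_nonneg _)
      · rw [integral_const_mul, ← intervalIntegral.integral_of_le (xs_lt n).le]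
        have e2 : ∫ u in xs n..xs (n + 1), ‖P (tt n u)‖ = xs n / 8 * ∫ t in (-1 : ℝ)..1, ‖P t‖ := by
          have : ∀ u, tt n u = (8 / xs n) * u - 9 := fun u => by unfold tt; ring
          simp_rw [this]
          rw [intervalIntegral.integral_comp_mul_sub (fun t => ‖P t‖) (by positivity), smul_eq_mul, xs_succ]
          have i1 : 8 / xs n * xs n - 9 = -1 := by field_simp; norm_num
          have i2 : 8 / xs n * (5 / 4 * xs n) - 9 = 1 := by field_simp; norm_num
          rw [i1, i2, inv_div]
        rw [e2]
        apply le_of_eq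
        ring)
  refine ⟨fun p => if h : p ∈ blk n then χ ⟨p, h⟩ else 0, B.map (Function.Embedding.subtype _), ?_, ?_, ?_, ?_, ?_⟩
  · intro p hp
    rw [Finset.mem_map] at hp
    obtain ⟨x, _, rfl⟩ := hp
    exact x.2
  · simpa using hB1
  · intro p hp
    simp only [hp, dif_pos]
    exact hχ1 _
  · intro p hp hpB
    simp only [hp, dif_pos]
    apply hB2
    intro hcon
    exact hpB (Finset.mem_map.mpr ⟨⟨p, hp⟩, hcon, rfl⟩)
  · intro k hk
    have := hχ2 ⟨k, hk⟩
    simp only [hz] at this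
    rw [← Finset.sum_coe_sort (blk n)]
    have e3 : ∑ p : {p // p ∈ blk n}, (if h : (p : ℕ) ∈ blk n then χ ⟨p, h⟩ else 0) *
        ((Real.log (p : ℕ) : ℂ) * (tt n (p : ℕ) : ℂ) ^ k) =
        ∑ p, χ p * ((Real.log (p : ℕ) : ℂ) * (tt n (p : ℕ) : ℂ) ^ k) := by
      refine Finset.sum_congr rfl fun p _ => ?_
      simp
    rw [e3, this]
    ring


noncomputable def Gb (q : ℝ → ℂ) (X : ℕ → ℂ) (n : ℕ) (s : ℂ) : ℂ :=
  (∫ u in Ioc (xs n) (xs (n + 1)), q u * (u : ℂ) ^ (-s)) +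
    ∑ p ∈ blk n, X p * (p : ℂ) ^ (-s) * (Real.log p : ℂ)

lemma norm_cpow_le (n : ℕ) {u : ℝ} (hu : xs n ≤ u) {s : ℂ} (hs : 1 / 2 ≤ s.re) :
    ‖(u : ℂ) ^ (-s)‖ ≤ xs n ^ (-(1 / 2) : ℝ) := by
  have hx := xs_one_le n
  have hu0 : 0 < u := by linarith
  rw [Complex.norm_cpow_eq_rpow_re_of_pos hu0]
  calc u ^ (-s).re ≤ u ^ (-(1 / 2) : ℝ) := by
        apply Real.rpow_le_rpow_of_exponent_le (by linarith)
        simp only [neg_re]; linarith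
    _ ≤ _ := Real.rpow_le_rpow_of_nonpos (by linarith) hu (by norm_num)

lemma cpow_approx (R : ℝ) : ∃ C : ℝ, 0 < C ∧ ∀ s : ℂ, ‖s‖ ≤ R → 1 / 2 ≤ s.re → ∀ n : ℕ, ∃ b : ℕ → ℂ,
    ∀ u : ℝ, xs n ≤ u → u ≤ xs (n + 1) →
      ‖(u : ℂ) ^ (-s) - ∑ k ∈ Finset.range n, b k * (tt n u : ℂ) ^ k‖ ≤
        C * (1 / 4) ^ n * xs n ^ (-(1 / 2) : ℝ) := by
  obtain ⟨C, hC, h⟩ := taylor_approx R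
  refine ⟨C, hC, fun s hs hs2 n => ?_⟩
  obtain ⟨b, hb⟩ := h s hs n
  set m : ℝ := 9 / 8 * xs n with hm
  have hx := xs_pos n
  refine ⟨fun k => (m : ℂ) ^ (-s) * b k, fun u h1 h2 => ?_⟩
  have ht := tt_mem n u h1 h2
  have hu : (u : ℂ) ^ (-s) = (m : ℂ) ^ (-s) * (1 + (tt n u : ℂ) / 9) ^ (-s) := by
    have e1 : u = m * (1 + tt n u / 9) := by rw [hm]; unfold tt; field_simp; ring
    have e2 : (1 + (tt n u : ℂ) / 9) = ((1 + tt n u / 9 : ℝ) : ℂ) := by push_cast; ring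
    rw [e2, ← Complex.mul_cpow_ofReal_nonneg (by positivity) (by linarith [ht.1]), ← Complex.ofReal_mul, ← e1]
  simp_rw [mul_assoc, ← Finset.mul_sum]
  rw [hu, ← mul_sub, norm_mul, mul_comm]
  rw [← mul_assoc]
  exact mul_le_mul (hb _ ht) (norm_cpow_le n (by rw [hm]; linarith) hs2) (norm_nonneg _) (by positivity)

lemma blk_log_sum (n : ℕ) : ∑ p ∈ blk n, Real.log p ≤ 2 * xs n := by
  have h1 := theta_diff (xs n) (xs (n + 1)) (xs_lt n).le
  have h2 := Chebyshev.theta_le_log4_mul_x (xs_pos (n + 1)).le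
  have h3 := Chebyshev.theta_nonneg (xs n)
  have h4 : Real.log 4 ≤ 1.4 := by
    rw [show (4:ℝ) = 2 ^ 2 by norm_num, Real.log_pow]
    have := Real.log_two_lt_d9
    push_cast; linarith
  have hx := xs_pos n
  have h5 : ∑ p ∈ blk n, Real.log p = Chebyshev.theta (xs (n + 1)) - Chebyshev.theta (xs n) := h1.symm
  rw [h5]
  rw [xs_succ] at h2 ⊢
  nlinarith

lemma blk_log (n p : ℕ) (hp : p ∈ blk n) : Real.log p ≤ n + 1 := by
  obtain ⟨h0, h1, h2⟩ := (mem_blk n p).mp hp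
  have hp0 : (0 : ℝ) < p := by exact_mod_cast h0.pos
  calc Real.log p ≤ Real.log (xs (n + 1)) := Real.log_le_log hp0 h2
    _ = (n + 1 : ℝ) * Real.log (5 / 4) := by unfold xs; rw [Real.log_pow]; push_cast; ring
    _ ≤ (n + 1 : ℝ) * 1 := by
      gcongr
      have := Real.log_le_sub_one_of_pos (show (0:ℝ) < 5/4 by norm_num)
      linarith
    _ = _ := mul_one _

lemma block_bound (R : ℝ) : ∃ C : ℝ, 0 < C ∧ ∀ (q : ℝ → ℂ) (_ : LocallyIntegrableOn q (Ici 1))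
    (n : ℕ) (χ X : ℕ → ℂ) (B : Finset ℕ), (∀ u, xs n ≤ u → ‖q u‖ ≤ 1) → 
      B ⊆ blk n → B.card ≤ n → (∀ p ∈ blk n, ‖χ p‖ ≤ 1) → (∀ p ∈ blk n, p ∉ B → X p = χ p) →
      (∀ p ∈ blk n, ‖X p‖ = 1) →
      (∀ k < n, (∫ u in Ioc (xs n) (xs (n + 1)), q u * (tt n u : ℂ) ^ k) +
        ∑ p ∈ blk n, χ p * ((Real.log p : ℂ) * (tt n p : ℂ) ^ k) = 0) →
      ∀ s : ℂ, ‖s‖ ≤ R → 1 / 2 ≤ s.re →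
        ‖Gb q X n s‖ ≤ (C + 2 * n * (n + 1)) * xs n ^ (-(1 / 2) : ℝ) := by
  obtain ⟨C, hC, hap⟩ := cpow_approx R
  refine ⟨3 * C, by positivity, ?_⟩
  intro q hqloc n χ X B hq hB hBc hχ hX hX1 hmom s hs hs2
  obtain ⟨b, hb⟩ := hap s hs hs2 n
  have hx := xs_pos n
  have hx1 := xs_one_le n
  set K := C * (1 / 4) ^ n * xs n ^ (-(1 / 2) : ℝ) with hK
  have hK0 : 0 ≤ K := by positivity
  set P : ℝ → ℂ := fun u => ∑ k ∈ Finset.range n, b k * (tt n u : ℂ) ^ k with hP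
  have httc : Continuous (tt n) := by unfold tt; fun_prop
  have hPc : Continuous P := by fun_prop
  have hcp : ContinuousOn (fun u : ℝ => (u : ℂ) ^ (-s)) (Icc (xs n) (xs (n + 1))) := by
    intro u hu
    have : 0 < u := by linarith [hu.1]
    exact (Complex.continuousAt_ofReal_cpow_const u (-s) (Or.inr this.ne')).continuousWithinAt
  have hP0 : (∫ u in Ioc (xs n) (xs (n + 1)), q u * P u) + ∑ p ∈ blk n, χ p * ((Real.log p : ℂ) * P p) = 0 := by
    have e1 : (∫ u in Ioc (xs n) (xs (n + 1)), q u * P u) =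
        ∑ k ∈ Finset.range n, b k * ∫ u in Ioc (xs n) (xs (n + 1)), q u * (tt n u : ℂ) ^ k := by
      simp only [hP, Finset.mul_sum]
      rw [integral_finsetSum]
      · refine Finset.sum_congr rfl fun k _ => ?_
        rw [← integral_const_mul]
        congr 1
        funext u
        ring
      · intro k _
        exact q_int hqloc hx1 (g := fun u => b k * (tt n u : ℂ) ^ k) (by fun_prop)
    have e2 : ∑ p ∈ blk n, χ p * ((Real.log p : ℂ) * P p) =
        ∑ k ∈ Finset.range n, b k * ∑ p ∈ blk n, χ p * ((Real.log p : ℂ) * (tt n p : ℂ) ^ k) := by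
      simp only [hP, Finset.mul_sum]
      rw [Finset.sum_comm]
      refine Finset.sum_congr rfl fun k _ => Finset.sum_congr rfl fun p _ => ?_
      ring
    rw [e1, e2, ← Finset.sum_add_distrib]
    refine Finset.sum_eq_zero fun k hk => ?_
    rw [← mul_add, hmom k (Finset.mem_range.mp hk), mul_zero]
  have hsplit : Gb q X n s = (∫ u in Ioc (xs n) (xs (n + 1)), q u * ((u : ℂ) ^ (-s) - P u)) +
      (∑ p ∈ blk n, χ p * ((Real.log p : ℂ) * ((p : ℂ) ^ (-s) - P p))) +
      ∑ p ∈ B, (X p - χ p) * (p : ℂ) ^ (-s) * (Real.log p : ℂ) := by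
    have e1 : (∫ u in Ioc (xs n) (xs (n + 1)), q u * ((u : ℂ) ^ (-s) - P u)) =
        (∫ u in Ioc (xs n) (xs (n + 1)), q u * (u : ℂ) ^ (-s)) - ∫ u in Ioc (xs n) (xs (n + 1)), q u * P u := by
      simp_rw [mul_sub]
      exact integral_sub (q_int hqloc hx1 hcp) (q_int hqloc hx1 hPc.continuousOn)
    have e2 : ∑ p ∈ B, (X p - χ p) * (p : ℂ) ^ (-s) * (Real.log p : ℂ) =
        ∑ p ∈ blk n, (X p - χ p) * (p : ℂ) ^ (-s) * (Real.log p : ℂ) := by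
      apply Finset.sum_subset hB
      intro p hp hpB
      rw [hX p hp hpB]; ring
    have e3 : ∑ p ∈ blk n, χ p * ((Real.log p : ℂ) * ((p : ℂ) ^ (-s) - P p)) =
        ∑ p ∈ blk n, χ p * (p : ℂ) ^ (-s) * (Real.log p : ℂ) - ∑ p ∈ blk n, χ p * ((Real.log p : ℂ) * P p) := by
      rw [← Finset.sum_sub_distrib]
      exact Finset.sum_congr rfl fun p _ => by ring
    have e4 : ∑ p ∈ blk n, (X p - χ p) * (p : ℂ) ^ (-s) * (Real.log p : ℂ) =
        ∑ p ∈ blk n, X p * (p : ℂ) ^ (-s) * (Real.log p : ℂ) - ∑ p ∈ blk n, χ p * (p : ℂ) ^ (-s) * (Real.log p : ℂ) := by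
      rw [← Finset.sum_sub_distrib]
      exact Finset.sum_congr rfl fun p _ => by ring
    rw [e1, e2, e3, e4, Gb]
    linear_combination hP0
  have b1 : ‖∫ u in Ioc (xs n) (xs (n + 1)), q u * ((u : ℂ) ^ (-s) - P u)‖ ≤ K * xs n := by
    have := norm_setIntegral_le_of_norm_le_const (μ := volume) (s := Ioc (xs n) (xs (n + 1))) (C := K)
      (f := fun u : ℝ => q u * ((u : ℂ) ^ (-s) - P u)) (by simp) (fun u hu => by
        rw [norm_mul]
        calc _ ≤ 1 * K := mul_le_mul (hq u hu.1.le) (hb u hu.1.le hu.2) (norm_nonneg _) zero_le_one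
          _ = K := one_mul _)
    refine this.trans ?_
    rw [Real.volume_real_Ioc_of_le (xs_lt n).le, xs_succ]
    nlinarith
  have b2 : ‖∑ p ∈ blk n, χ p * ((Real.log p : ℂ) * ((p : ℂ) ^ (-s) - P p))‖ ≤ K * (2 * xs n) := by
    refine (norm_sum_le _ _).trans ?_
    refine le_trans ?_ (mul_le_mul_of_nonneg_left (blk_log_sum n) hK0)
    rw [Finset.mul_sum]
    refine Finset.sum_le_sum fun p hp => ?_
    obtain ⟨h0, h1, h2⟩ := (mem_blk n p).mp hp
    have h3 := hb p h1.le h2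
    have h4 := Real.log_natCast_nonneg p
    rw [norm_mul, norm_mul, Complex.norm_real, Real.norm_of_nonneg h4]
    have h5 : ‖((p : ℂ) ^ (-s) - P p)‖ ≤ K := by simpa using h3
    calc _ ≤ 1 * (Real.log p * K) := by
          gcongr
          exact hχ p hp
      _ = _ := by ring
  have b3 : ‖∑ p ∈ B, (X p - χ p) * (p : ℂ) ^ (-s) * (Real.log p : ℂ)‖ ≤
      2 * n * (n + 1) * xs n ^ (-(1 / 2) : ℝ) := by
    have hpt : ∀ p ∈ B, ‖(X p - χ p) * (p : ℂ) ^ (-s) * (Real.log p : ℂ)‖ ≤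
        2 * xs n ^ (-(1 / 2) : ℝ) * (n + 1) := by
      intro p hp
      have hp := hB hp
      obtain ⟨h0, h1, h2⟩ := (mem_blk n p).mp hp
      have h3 : ‖(p : ℂ) ^ (-s)‖ ≤ xs n ^ (-(1 / 2) : ℝ) := by simpa using norm_cpow_le n h1.le hs2
      have h4 := Real.log_natCast_nonneg p
      rw [norm_mul, norm_mul, Complex.norm_real, Real.norm_of_nonneg h4]
      have h5 : ‖X p - χ p‖ ≤ 2 := by
        refine (norm_sub_le _ _).trans ?_
        linarith [hX1 p hp, hχ p hp]
      have := blk_log n p hp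
      gcongr
    refine (norm_sum_le_of_le B hpt).trans ?_
    rw [Finset.sum_const, nsmul_eq_mul]
    have : (B.card : ℝ) ≤ n := by exact_mod_cast hBc
    calc _ ≤ (n : ℝ) * (2 * xs n ^ (-(1 / 2) : ℝ) * (n + 1)) := by gcongr
      _ = _ := by ring
  have hKx : K * xs n ≤ C * xs n ^ (-(1 / 2) : ℝ) := by
    have : (1 / 4 : ℝ) ^ n * xs n ≤ 1 := by
      unfold xs
      rw [← mul_pow]
      exact pow_le_one₀ (by norm_num) (by norm_num)
    calc K * xs n = C * xs n ^ (-(1 / 2) : ℝ) * ((1 / 4 : ℝ) ^ n * xs n) := by rw [hK]; ring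
      _ ≤ C * xs n ^ (-(1 / 2) : ℝ) * 1 := by gcongr
      _ = _ := mul_one _
  rw [hsplit]
  refine (norm_add₃_le).trans ?_
  linarith


lemma Gb_diff {q : ℝ → ℂ} (hqloc : LocallyIntegrableOn q (Ici 1)) (X : ℕ → ℂ) (n : ℕ) :
    Differentiable ℂ (Gb q X n) := by
  have hx := xs_one_le n
  have h1 : Differentiable ℂ (fun s : ℂ => ∫ u in Ioc (xs n) (xs (n + 1)), q u * (u : ℂ) ^ (-s)) := by
    set f : ℝ → ℂ := indicator (Ioc (xs n) (xs (n + 1))) q with hf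
    have hfi : Integrable f := by
      rw [hf, integrable_indicator_iff measurableSet_Ioc]
      have := q_int (q := q) hqloc (a := xs n) (b := xs (n + 1)) (g := fun _ => 1) hx continuousOn_const
      simpa using this
    have e : (fun s : ℂ => ∫ u in Ioc (xs n) (xs (n + 1)), q u * (u : ℂ) ^ (-s)) =
        fun s => mellin f (1 - s) := by
      ext s
      unfold mellin
      have : ∀ u : ℝ, (u : ℂ) ^ (1 - s - 1) • f u =
          indicator (Ioc (xs n) (xs (n + 1))) (fun u => q u * (u : ℂ) ^ (-s)) u := by
        intro u
        by_cases hu : u ∈ Ioc (xs n) (xs (n + 1))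
        · simp only [hf, indicator_of_mem hu, smul_eq_mul]; rw [mul_comm]; congr 2; ring
        · simp [hf, indicator_of_notMem hu]
      simp_rw [this]
      rw [setIntegral_indicator measurableSet_Ioc]
      congr 2
      ext u
      simp only [mem_inter_iff, mem_Ioi, mem_Ioc]
      constructor
      · intro h; exact ⟨by linarith [h.1], h⟩
      · exact fun h => h.2
    rw [e]
    intro s
    have hd : DifferentiableAt ℂ (mellin f) (1 - s) := by
      refine mellin_differentiableAt_of_isBigO_rpow (a := (1 - s).re + 1) (b := (1 - s).re - 1)
        (hfi.locallyIntegrable.locallyIntegrableOn _) ?_ (by linarith) ?_ (by linarith)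
      · refine (Asymptotics.isBigO_zero _ _).congr' ?_ EventuallyEq.rfl
        filter_upwards [eventually_gt_atTop (xs (n + 1))] with u hu
        rw [hf, indicator_of_notMem]
        intro h; exact absurd h.2 (not_le.mpr hu)
      · refine (Asymptotics.isBigO_zero _ _).congr' ?_ EventuallyEq.rfl
        filter_upwards [nhdsWithin_le_nhds (Iio_mem_nhds (show (0:ℝ) < 1 by norm_num))] with u hu
        rw [hf, indicator_of_notMem]
        intro h; have := h.1; simp only [mem_Iio] at hu; linarith
    exact DifferentiableAt.comp (g := mellin f) (f := fun s : ℂ => 1 - s) s hd (by fun_prop)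
  have h2 : Differentiable ℂ (fun s : ℂ => ∑ p ∈ blk n, X p * (p : ℂ) ^ (-s) * (Real.log p : ℂ)) := by
    apply Differentiable.fun_sum
    intro p hp
    have hp0 : (p : ℂ) ≠ 0 := by
      have := ((mem_blk n p).mp hp).1.ne_zero
      exact_mod_cast this
    apply Differentiable.mul_const
    apply Differentiable.const_mul
    intro s
    exact DifferentiableAt.const_cpow (by fun_prop) (Or.inl hp0)
  exact h1.add h2

lemma bnd_summable (C : ℝ) : Summable (fun n : ℕ => (C + 2 * n * (n + 1)) * xs n ^ (-(1 / 2) : ℝ)) := by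
  set r : ℝ := (5 / 4 : ℝ) ^ (-(1 / 2) : ℝ) with hr
  have hr0 : 0 < r := by positivity
  have hr1 : ‖r‖ < 1 := by
    rw [Real.norm_of_nonneg hr0.le]
    exact Real.rpow_lt_one_of_one_lt_of_neg (by norm_num) (by norm_num)
  have e : ∀ n : ℕ, xs n ^ (-(1 / 2) : ℝ) = r ^ n := by
    intro n
    unfold xs
    rw [hr, ← Real.rpow_natCast, ← Real.rpow_natCast, ← Real.rpow_mul (by norm_num),
      ← Real.rpow_mul (by norm_num), mul_comm]
  have h0 := summable_pow_mul_geometric_of_norm_lt_one 0 hr1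
  have h1 := summable_pow_mul_geometric_of_norm_lt_one 1 hr1
  have h2 := summable_pow_mul_geometric_of_norm_lt_one 2 hr1
  refine (((h0.mul_left C).add (h1.mul_left 2)).add (h2.mul_left 2)).congr fun n => ?_
  rw [e]; ring

lemma xs_zero : xs 0 = 1 := by unfold xs; simp

lemma xs_tendsto : Tendsto xs atTop atTop := by
  unfold xs
  exact tendsto_pow_atTop_atTop_of_one_lt (by norm_num)

lemma xs_mono : StrictMono xs := strictMono_nat_of_lt_succ xs_lt

lemma blk_unique {m n p : ℕ} (hm : p ∈ blk m) (hn : p ∈ blk n) : m = n := by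
  obtain ⟨_, h1, h2⟩ := (mem_blk m p).mp hm
  obtain ⟨_, h3, h4⟩ := (mem_blk n p).mp hn
  have a : m < n + 1 := xs_mono.lt_iff_lt.mp (h1.trans_le h4)
  have b : n < m + 1 := xs_mono.lt_iff_lt.mp (h3.trans_le h2)
  omega

lemma Gb_partial {q : ℝ → ℂ} (hqloc : LocallyIntegrableOn q (Ici 1)) (X : ℕ → ℂ) (s : ℂ) (n : ℕ) :
    ∑ j ∈ Finset.range n, Gb q X j s = (∫ u in (1 : ℝ)..xs n, q u * (u : ℂ) ^ (-s)) +
      ∑ p ∈ Finset.range (⌊xs n⌋₊ + 1),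
        indicator {p : ℕ | p.Prime} (fun p => X p * (p : ℂ) ^ (-s) * (Real.log p : ℂ)) p := by
  have hIntg : ∀ b, IntegrableOn (fun u : ℝ => q u * (u : ℂ) ^ (-s)) (Ioc 1 b) := by
    intro b
    refine q_int hqloc (g := fun u : ℝ => (u : ℂ) ^ (-s)) le_rfl ?_
    intro u hu
    refine ContinuousAt.continuousWithinAt ?_
    exact continuousAt_ofReal_cpow_const _ _ (Or.inr (by linarith [hu.1]))
  induction n with
  | zero =>
    rw [xs_zero]
    simp [Finset.sum_range_succ, indicator_apply, Nat.not_prime_zero, Nat.not_prime_one]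
  | succ n ih =>
    rw [Finset.sum_range_succ, ih]
    have hx := xs_one_le n
    have hl := xs_lt n
    have i1 : (∫ u in (1 : ℝ)..xs (n + 1), q u * (u : ℂ) ^ (-s)) =
        (∫ u in (1 : ℝ)..xs n, q u * (u : ℂ) ^ (-s)) +
          ∫ u in Ioc (xs n) (xs (n + 1)), q u * (u : ℂ) ^ (-s) := by
      rw [← intervalIntegral.integral_of_le hl.le, intervalIntegral.integral_add_adjacent_intervals]
      · rw [intervalIntegrable_iff_integrableOn_Ioc_of_le hx]; exact hIntg _
      · rw [intervalIntegrable_iff_integrableOn_Ioc_of_le hl.le]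
        exact (hIntg (xs (n + 1))).mono_set (Ioc_subset_Ioc_left hx)
    have hle : ⌊xs n⌋₊ ≤ ⌊xs (n + 1)⌋₊ := Nat.floor_le_floor hl.le
    have i2 : ∀ f : ℕ → ℂ, ∑ p ∈ Finset.range (⌊xs (n + 1)⌋₊ + 1), indicator {p : ℕ | p.Prime} f p =
        ∑ p ∈ Finset.range (⌊xs n⌋₊ + 1), indicator {p : ℕ | p.Prime} f p + ∑ p ∈ blk n, f p := by
      intro f
      have : ∑ p ∈ blk n, f p = ∑ p ∈ Finset.Ico (⌊xs n⌋₊ + 1) (⌊xs (n + 1)⌋₊ + 1),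
          indicator {p : ℕ | p.Prime} f p := by
        unfold blk
        rw [Finset.sum_filter]
        refine Finset.sum_congr ?_ fun p _ => by simp [indicator_apply]
        ext p; simp only [Finset.mem_Ioc, Finset.mem_Ico]; omega
      rw [this, Finset.sum_range_add_sum_Ico _ (by omega)]
    rw [i1, i2, Gb]; ring

lemma Gb_limit {q : ℝ → ℂ} (hq0 : Tendsto q atTop (𝓝 0)) (hqloc : LocallyIntegrableOn q (Ici 1))
    (X : ℕ → ℂ) (hX : ∀ p, ‖X p‖ = 1) (s : ℂ) (hs : 1 < s.re) :
    Tendsto (fun n => ∑ j ∈ Finset.range n, Gb q X j s) atTop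
      (𝓝 ((∫ x in Ioi (1 : ℝ), q x * (x : ℂ) ^ (-s)) +
            ∑' p : Nat.Primes, X (p : ℕ) * ((p : ℕ) : ℂ) ^ (-s) * (Real.log (p : ℕ) : ℂ))) := by
  simp_rw [Gb_partial hqloc]
  refine Tendsto.add ?_ ?_
  · refine intervalIntegral_tendsto_integral_Ioi 1 ?_ xs_tendsto
    obtain ⟨U, hU⟩ := eventually_atTop.mp (hq0.norm.eventually (Iio_mem_nhds (show ‖(0:ℂ)‖ < 1 by simp)))
    set V := max U 1 with hV
    have hV1 : 1 ≤ V := le_max_right _ _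
    have hc : ∀ a b : ℝ, 0 < a → ContinuousOn (fun u : ℝ => (u : ℂ) ^ (-s)) (Ici a) := by
      intro a b ha u hu
      refine ContinuousAt.continuousWithinAt ?_
      exact continuousAt_ofReal_cpow_const _ _ (Or.inr (by have := mem_Ici.mp hu; linarith))
    have e : Ioi (1 : ℝ) = Ioc 1 V ∪ Ioi V := (Ioc_union_Ioi_eq_Ioi hV1).symm
    rw [e, integrableOn_union]
    refine ⟨q_int hqloc (g := fun u : ℝ => (u : ℂ) ^ (-s)) le_rfl
      ((hc 1 1 one_pos).mono Icc_subset_Ici_self), ?_⟩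
    refine Integrable.mono' (integrableOn_Ioi_rpow_of_lt (a := -s.re) (by linarith) (c := V) (by linarith)) ?_ ?_
    · refine AEStronglyMeasurable.mul ?_ ?_
      · have h1 : AEStronglyMeasurable q (volume.restrict (Ici 1)) := hqloc.aestronglyMeasurable
        exact h1.mono_set (fun u hu => by have := mem_Ioi.mp hu; exact mem_Ici.mpr (by linarith))
      · exact ((hc V 1 (by linarith)).mono Ioi_subset_Ici_self).aestronglyMeasurable measurableSet_Ioi
    · filter_upwards [self_mem_ae_restrict measurableSet_Ioi] with u hu
      have hu' : V < u := hu
      rw [norm_mul, Complex.norm_cpow_eq_rpow_re_of_pos (by linarith), neg_re]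
      have h1 := hU u ((le_max_left U 1).trans hu'.le)
      have h2 : 0 ≤ u ^ (-s.re) := by apply Real.rpow_nonneg; linarith
      have h3 : ‖q u‖ ≤ 1 := le_of_lt h1
      nlinarith
  · set F : ℕ → ℂ := fun p => X p * (p : ℂ) ^ (-s) * (Real.log p : ℂ) with hF
    have hsum : Summable (indicator {p : ℕ | p.Prime} F) := by
      have h := (ArithmeticFunction.LSeriesSummable_vonMangoldt hs).norm
      refine Summable.of_norm_bounded h fun p => ?_
      by_cases hp : p.Prime
      · rw [indicator_of_mem (by exact hp), LSeries.norm_term_eq, if_neg hp.ne_zero,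
          ArithmeticFunction.vonMangoldt_apply_prime hp, hF]
        simp only [norm_mul, hX, one_mul]
        rw [Complex.norm_natCast_cpow_of_pos hp.pos, neg_re, Real.rpow_neg (by positivity)]
        rw [mul_comm, div_eq_mul_inv]
      · rw [indicator_of_notMem (by exact hp)]; simp
    have e : ∑' p : Nat.Primes, X (p : ℕ) * ((p : ℕ) : ℂ) ^ (-s) * (Real.log (p : ℕ) : ℂ) =
        ∑' p, indicator {p : ℕ | p.Prime} F p := (tsum_subtype {p : ℕ | p.Prime} F)
    rw [e]
    refine hsum.hasSum.tendsto_sum_nat.comp ?_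
    exact (tendsto_add_atTop_nat 1).comp (tendsto_nat_floor_atTop.comp xs_tendsto)

lemma exists_X {q : ℝ → ℂ} (hq0 : Tendsto q atTop (𝓝 0)) (hqloc : LocallyIntegrableOn q (Ici 1)) :
    ∃ X : ℕ → ℂ, (∀ p, ‖X p‖ = 1) ∧ ∃ n0 : ℕ, ∀ R : ℝ, ∃ C : ℝ, ∀ n, n0 ≤ n → ∀ s : ℂ, ‖s‖ ≤ R →
      1 / 2 ≤ s.re → ‖Gb q X n s‖ ≤ (C + 2 * n * (n + 1)) * xs n ^ (-(1 / 2) : ℝ) := by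
  classical
  obtain ⟨n0, h⟩ := block_choice hq0 hqloc
  choose hq c B h1 h2 h3 h4 h5 using h
  set X : ℕ → ℂ := fun p => if hp : ∃ n, ∃ hn : n0 ≤ n, p ∈ blk n ∧ p ∉ B n hn then
    c hp.choose hp.choose_spec.choose p else 1 with hX
  have hX1 : ∀ n (hn : n0 ≤ n) p, p ∈ blk n → p ∉ B n hn → X p = c n hn p := by
    intro n hn p hp hpB
    have hex : ∃ n, ∃ hn : n0 ≤ n, p ∈ blk n ∧ p ∉ B n hn := ⟨n, hn, hp, hpB⟩
    have e : hex.choose = n := blk_unique hex.choose_spec.choose_spec.1 hp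
    simp only [hX, dif_pos hex]
    congr 1
  have hXn : ∀ p, ‖X p‖ = 1 := by
    intro p
    by_cases hex : ∃ n, ∃ hn : n0 ≤ n, p ∈ blk n ∧ p ∉ B n hn
    · obtain ⟨n, hn, hp, hpB⟩ := hex
      rw [hX1 n hn p hp hpB]; exact h4 n hn p hp hpB
    · simp only [hX, dif_neg hex, norm_one]
  refine ⟨X, hXn, n0, fun R => ?_⟩
  obtain ⟨C, _, hb⟩ := block_bound R
  exact ⟨C, fun n hn s hs hs2 => hb q hqloc n (c n hn) X (B n hn) (hq n hn) (h1 n hn) (h2 n hn) (h3 n hn)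
    (hX1 n hn) (fun p _ => hXn p) (h5 n hn) s hs hs2⟩

lemma mult_ext (X : ℕ → ℂ) (hX : ∀ p, ‖X p‖ = 1) : ∃ χ : ℕ → ℂ, χ 1 = 1 ∧
    (∀ m n : ℕ, χ (m * n) = χ m * χ n) ∧ (∀ n : ℕ, 1 ≤ n → ‖χ n‖ = 1) ∧
    ∀ p : ℕ, p.Prime → χ p = X p := by
  refine ⟨fun n => if n = 0 then 0 else (n.primeFactorsList.map X).prod, by simp, ?_, ?_, ?_⟩
  · intro m n
    by_cases hm : m = 0
    · simp [hm]
    by_cases hn : n = 0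
    · simp [hn]
    simp only [hm, hn, mul_eq_zero, or_self, if_false]
    rw [((Nat.perm_primeFactorsList_mul hm hn).map X).prod_eq, List.map_append, List.prod_append]
  · intro n hn
    have : n ≠ 0 := by omega
    simp only [this, if_false]
    generalize n.primeFactorsList = l
    induction l with
    | nil => simp
    | cons a l ih => simp [hX, ih]
  · intro p hp
    simp [hp.ne_zero, Nat.primeFactorsList_prime hp]

theorem integral_add_prime_sum_extends (q : ℝ → ℂ)
    (hq0 : Tendsto q atTop (𝓝 0))
    (hqloc : LocallyIntegrableOn q (Ici 1)) :
    ∃ χ : ℕ → ℂ, χ 1 = 1 ∧ (∀ m n : ℕ, χ (m * n) = χ m * χ n) ∧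
      (∀ n : ℕ, 1 ≤ n → ‖χ n‖ = 1) ∧
      ∃ G : ℂ → ℂ, AnalyticOnNhd ℂ G {s : ℂ | 21 / 40 < s.re} ∧
        ∀ s : ℂ, 1 < s.re →
          G s = (∫ x in Ioi (1 : ℝ), q x * (x : ℂ) ^ (-s)) +
            ∑' p : Nat.Primes, χ (p : ℕ) * ((p : ℕ) : ℂ) ^ (-s) * (Real.log (p : ℕ) : ℂ) := by
  obtain ⟨X, hX, n0, hb⟩ := exists_X hq0 hqloc
  obtain ⟨χ, hχ1, hχm, hχn, hχp⟩ := mult_ext X hX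
  refine ⟨χ, hχ1, hχm, hχn, fun s => ∑ n ∈ Finset.range n0, Gb q X n s + ∑' n, Gb q X (n + n0) s, ?_, ?_⟩
  · have hO : IsOpen {s : ℂ | 21 / 40 < s.re} := isOpen_lt continuous_const continuous_re
    refine DifferentiableOn.analyticOnNhd ?_ hO
    refine DifferentiableOn.add (DifferentiableOn.fun_sum fun n _ => (Gb_diff hqloc X n).differentiableOn) ?_
    intro s hs
    refine DifferentiableAt.differentiableWithinAt ?_
    obtain ⟨C, hC⟩ := hb (‖s‖ + 1)
    have hO2 : IsOpen {z : ℂ | 21 / 40 < z.re ∧ ‖z‖ < ‖s‖ + 1} :=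
      hO.inter (isOpen_lt continuous_norm continuous_const)
    have hd := differentiableOn_tsum_of_summable_norm (F := fun n s => Gb q X (n + n0) s)
      ((summable_nat_add_iff n0).mpr (bnd_summable C))
      (fun n => (Gb_diff hqloc X (n + n0)).differentiableOn) hO2
      (fun n w hw => hC (n + n0) (by omega) w hw.2.le (by have := hw.1; linarith))
    exact hd.differentiableAt (hO2.mem_nhds ⟨hs, by linarith⟩)
  · intro s hs
    obtain ⟨C, hC⟩ := hb ‖s‖
    have hsum : Summable fun n => Gb q X (n + n0) s :=
      Summable.of_norm_bounded ((summable_nat_add_iff n0).mpr (bnd_summable C))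
        (fun n => hC (n + n0) (by omega) s le_rfl (by linarith))
    have e : ∀ p : Nat.Primes, χ (p : ℕ) = X (p : ℕ) := fun p => hχp p p.2
    simp_rw [e]
    have hs2 : Summable fun n => Gb q X n s := (summable_nat_add_iff n0).mp hsum
    rw [hs2.sum_add_tsum_nat_add n0]
    exact tendsto_nhds_unique hs2.hasSum.tendsto_sum_nat (Gb_limit hq0 hqloc X hX s hs)
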